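/- arXiv:1512.01210 — 2 statements merged into one kernel-verified Lean document; each statement's English description precedes it below -/
import Mathlib

section
/- For every ε > 0 and every M, there exist finite sets X and Y and a function F : X × Y → {0,1} such that log₂ χ(F) ≥ M and D^cc(F) ≥ (log₂ χ(F))^(2−ε). (That is, deterministic communication complexity can be nearly quadratically larger than the logarithm of the partition number, matching the upper bound D^cc(F) = O(log² χ(F)) up to lower-order terms.) -/
/-! ### Communication complexity and partition number -/

/-- Deterministic communication protocols: binary protocol trees where each
internal node is owned by one of the two players. -/
inductive Protocol (X Y : Type) where
  | leaf : Bool → Protocol X Y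
  | nodeA : (X → Bool) → Protocol X Y → Protocol X Y → Protocol X Y
  | nodeB : (Y → Bool) → Protocol X Y → Protocol X Y → Protocol X Y

/-- The output of a protocol on input `(x, y)`. -/
def Protocol.eval {X Y : Type} : Protocol X Y → X → Y → Bool
  | .leaf b, _, _ => b
  | .nodeA g t0 t1, x, y => if g x then t1.eval x y else t0.eval x y
  | .nodeB g t0 t1, x, y => if g y then t1.eval x y else t0.eval x y

/-- The depth (worst-case number of bits communicated) of a protocol. -/
def Protocol.depth {X Y : Type} : Protocol X Y → ℕ
  | .leaf _ => 0
  | .nodeA _ t0 t1 => 1 + max t0.depth t1.depth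
  | .nodeB _ t0 t1 => 1 + max t0.depth t1.depth

/-- Deterministic communication complexity `D^cc(F)`. -/
noncomputable def Dcc {X Y : Type} (F : X → Y → Bool) : ℕ :=
  sInf {d : ℕ | ∃ P : Protocol X Y, P.depth ≤ d ∧ ∀ x y, P.eval x y = F x y}

/-- A monochromatic rectangle for `F`. -/
def IsMonoRect {X Y : Type} (F : X → Y → Bool) (R : Set (X × Y)) : Prop :=
  (∃ A : Set X, ∃ B : Set Y, R = A ×ˢ B) ∧ ∃ b : Bool, ∀ z ∈ R, F z.1 z.2 = b

/-- The partition number `χ(F)`: the least number of monochromatic rectangles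
partitioning `X × Y`. -/
noncomputable def partitionNumber {X Y : Type} (F : X → Y → Bool) : ℕ :=
  sInf {t : ℕ | ∃ R : Fin t → Set (X × Y), (∀ i, IsMonoRect F (R i)) ∧
    ∀ z : X × Y, ∃! i, z ∈ R i}

namespace QueryLifting

open Finset Function

set_option linter.unusedSectionVars false

/-! ### Cylinders and thick sets -/

section Thickness

variable {ι : Type} [Fintype ι] [DecidableEq ι] {m : ℕ}

/-- The cylinder over the projection of `A` forgetting coordinate `i`. -/
def cyl (i : ι) (A : Finset (ι → Fin m)) : Finset (ι → Fin m) :=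
  univ.filter fun x => ∃ α, update x i α ∈ A

/-- The fiber of `A` through `x` in direction `i`. -/
def fib (i : ι) (A : Finset (ι → Fin m)) (x : ι → Fin m) : Finset (Fin m) :=
  univ.filter fun α => update x i α ∈ A

/-- Every nonempty fiber of `A` in a direction of `J` has at least `τ` elements. -/
def Thick (J : Finset ι) (τ : ℕ) (A : Finset (ι → Fin m)) : Prop :=
  ∀ x ∈ A, ∀ i ∈ J, τ ≤ (fib i A x).card

lemma mem_cyl {i : ι} {A : Finset (ι → Fin m)} {x : ι → Fin m} :
    x ∈ cyl i A ↔ ∃ α, update x i α ∈ A := by simp [cyl]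

lemma mem_fib {i : ι} {A : Finset (ι → Fin m)} {x : ι → Fin m} {α : Fin m} :
    α ∈ fib i A x ↔ update x i α ∈ A := by simp [fib]

lemma subset_cyl (i : ι) (A : Finset (ι → Fin m)) : A ⊆ cyl i A := fun x hx =>
  mem_cyl.2 ⟨x i, by simpa using hx⟩

lemma cyl_mono (i : ι) {A A' : Finset (ι → Fin m)} (h : A ⊆ A') : cyl i A ⊆ cyl i A' :=
  fun x hx => by
    obtain ⟨α, hα⟩ := mem_cyl.1 hx
    exact mem_cyl.2 ⟨α, h hα⟩

lemma Thick.cyl {J : Finset ι} {τ : ℕ} {A : Finset (ι → Fin m)} (h : Thick J τ A) (i : ι) :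
    Thick (J.erase i) τ (cyl i A) := by
  intro x hx j hj
  obtain ⟨α, hα⟩ := mem_cyl.1 hx
  have hji : j ≠ i := (mem_erase.1 hj).1
  refine (h _ hα j (mem_erase.1 hj).2).trans (card_le_card fun β hβ => ?_)
  rw [mem_fib] at hβ ⊢
  rw [update_comm hji.symm] at hβ
  exact mem_cyl.2 ⟨α, hβ⟩

lemma exists_thick_subset (J : Finset ι) (τ : ℕ) (A : Finset (ι → Fin m)) (hm : 0 < m)
    (h : 2 * (τ * ∑ i ∈ J, (cyl i A).card) ≤ m * A.card) :
    ∃ A' ⊆ A, A.card ≤ 2 * A'.card ∧ Thick J τ A' := by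
  let Φ : Finset (ι → Fin m) → ℤ := fun S => m * S.card - τ * ∑ i ∈ J, ((cyl i S).card : ℤ)
  obtain ⟨A', hA', hmax⟩ := exists_max_image A.powerset Φ ⟨A, by simp⟩
  rw [mem_powerset] at hA'
  refine ⟨A', hA', ?_, ?_⟩
  · have h1 : Φ A ≤ Φ A' := hmax A (by simp)
    have h2 : Φ A' ≤ m * A'.card := by
      have : (0 : ℤ) ≤ τ * ∑ i ∈ J, ((cyl i A').card : ℤ) :=
        mul_nonneg (Nat.cast_nonneg _) (sum_nonneg fun _ _ => Nat.cast_nonneg _)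
      simp only [Φ]; linarith
    have h3 : (m * A.card : ℤ) ≤ 2 * Φ A := by
      have : (2 * (τ * ∑ i ∈ J, ((cyl i A).card : ℤ)) : ℤ) ≤ m * A.card := by exact_mod_cast h
      simp only [Φ]; linarith
    have h4 : m * A.card ≤ m * (2 * A'.card) := by
      have : (m * A.card : ℤ) ≤ m * (2 * A'.card) := by linarith
      exact_mod_cast this
    exact Nat.le_of_mul_le_mul_left h4 hm
  · intro x hx i hi
    by_contra! hlt
    have hinj : Injective (update x i) := update_injective x i
    obtain ⟨line, hmem, hline⟩ : ∃ line : Finset (ι → Fin m),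
        (∀ y, y ∈ line ↔ ∃ α, update x i α = y) ∧ line.card = m :=
      ⟨univ.image (update x i), by simp, by
        rw [card_image_of_injective _ hinj, card_univ, Fintype.card_fin]⟩
    have hcap : (A' ∩ line).card = (fib i A' x).card := by
      rw [← card_image_of_injective (fib i A' x) hinj]
      congr 1
      ext y
      simp only [mem_inter, mem_image, hmem, mem_fib]
      constructor
      · rintro ⟨hy, α, rfl⟩; exact ⟨α, hy, rfl⟩
      · rintro ⟨α, hy, rfl⟩; exact ⟨hy, α, rfl⟩
    have hcard : (A' \ line).card + (fib i A' x).card = A'.card := by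
      rw [← hcap]; exact card_sdiff_add_card_inter A' line
    have hsub : line ⊆ cyl i A' := by
      intro y hy
      rw [hmem] at hy
      obtain ⟨α, rfl⟩ := hy
      exact mem_cyl.2 ⟨x i, by simpa using hx⟩
    have hcyl : (cyl i (A' \ line)).card + m ≤ (cyl i A').card := by
      have : cyl i (A' \ line) ⊆ cyl i A' \ line := by
        intro y hy
        obtain ⟨α, hα⟩ := mem_cyl.1 hy
        rw [mem_sdiff] at hα ⊢
        refine ⟨mem_cyl.2 ⟨α, hα.1⟩, fun hy' => hα.2 ?_⟩
        rw [hmem] at hy' ⊢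
        obtain ⟨β, rfl⟩ := hy'
        exact ⟨α, by simp⟩
      have h1 := card_le_card this
      have h2 := card_sdiff_add_card_eq_card hsub
      omega
    have hsum : ∑ j ∈ J, ((cyl j (A' \ line)).card : ℤ) + m ≤ ∑ j ∈ J, ((cyl j A').card : ℤ) := by
      rw [← add_sum_erase _ _ hi, ← add_sum_erase _ _ hi]
      have : ∑ j ∈ J.erase i, ((cyl j (A' \ line)).card : ℤ)
          ≤ ∑ j ∈ J.erase i, ((cyl j A').card : ℤ) :=
        sum_le_sum fun j _ => by exact_mod_cast card_le_card (cyl_mono j sdiff_subset)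
      have h' : ((cyl i (A' \ line)).card : ℤ) + m ≤ (cyl i A').card := by exact_mod_cast hcyl
      linarith
    have hle := hmax (A' \ line) (mem_powerset.2 (sdiff_subset.trans hA'))
    have hc : ((A' \ line).card : ℤ) + (fib i A' x).card = A'.card := by exact_mod_cast hcard
    have hlt' : ((fib i A' x).card : ℤ) + 1 ≤ τ := by exact_mod_cast hlt
    have hm' : (0 : ℤ) < m := by exact_mod_cast hm
    simp only [Φ] at hle
    have hτ : (0 : ℤ) ≤ τ := by positivity
    nlinarith [mul_le_mul_of_nonneg_left hsum hτ, mul_le_mul_of_nonneg_left hlt' hm'.le]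

end Thickness

/-! ### Hitting lemmas -/

lemma card_dead_le {m C : ℕ} (S : Finset (Fin m → Bool)) (b : Bool) (hS : 2 ^ m ≤ S.card * 2 ^ C) :
    (univ.filter fun j : Fin m => (S.filter fun v => v j = b).card * (2 * m) < S.card).card
      ≤ C + 1 := by
  set J := univ.filter fun j : Fin m => (S.filter fun v => v j = b).card * (2 * m) < S.card with hJ
  rcases Nat.eq_zero_or_pos m with rfl | hm
  · simp [Subsingleton.elim J ∅]
  have hhit : (S.filter fun v => ∃ j ∈ J, v j = b).card * (2 * m) ≤ J.card * S.card := by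
    have h1 : (S.filter fun v => ∃ j ∈ J, v j = b)
        ⊆ J.biUnion fun j => S.filter fun v => v j = b := by
      intro v hv
      simp only [mem_filter, mem_biUnion] at hv ⊢
      obtain ⟨hv, j, hj, hb⟩ := hv
      exact ⟨j, hj, hv, hb⟩
    calc _ ≤ (∑ j ∈ J, (S.filter fun v => v j = b).card) * (2 * m) :=
          Nat.mul_le_mul_right _ ((card_le_card h1).trans card_biUnion_le)
      _ = ∑ j ∈ J, (S.filter fun v => v j = b).card * (2 * m) := by rw [sum_mul]
      _ ≤ ∑ j ∈ J, S.card := sum_le_sum fun j hj => (mem_filter.1 hj).2.le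
      _ = _ := by simp
  have hJm : J.card ≤ m := by simpa using card_le_univ J
  have hhit2 : 2 * (S.filter fun v => ∃ j ∈ J, v j = b).card ≤ S.card := by
    have h2 : (S.filter fun v => ∃ j ∈ J, v j = b).card * (2 * m) ≤ m * S.card :=
      hhit.trans (Nat.mul_le_mul_right _ hJm)
    have h3 : m * (2 * (S.filter fun v => ∃ j ∈ J, v j = b).card) ≤ m * S.card := by
      linarith
    exact Nat.le_of_mul_le_mul_left h3 hm
  have hmiss : (S.filter fun v => ¬ ∃ j ∈ J, v j = b).card ≤ 2 ^ (m - J.card) := by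
    have hinj : Set.InjOn (fun (v : Fin m → Bool) (j : {j // j ∉ J}) => v j)
        (S.filter fun v => ¬ ∃ j ∈ J, v j = b) := by
      intro v hv w hw hvw
      simp only [coe_filter, Set.mem_ofPred_eq, not_exists, not_and] at hv hw
      funext j
      by_cases hj : j ∈ J
      · have h1 := hv.2 j hj
        have h2 := hw.2 j hj
        revert h1 h2
        cases v j <;> cases w j <;> cases b <;> simp
      · exact congrFun hvw ⟨j, hj⟩
    have := card_le_card_of_injOn (t := univ) _ (fun _ _ => mem_univ _) hinj
    simpa [Fintype.card_subtype_compl] using this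
  have hsplit := card_filter_add_card_filter_not (s := S) (fun v => ∃ j ∈ J, v j = b)
  have hS2 : S.card ≤ 2 * 2 ^ (m - J.card) := by omega
  have hpow : 2 ^ m ≤ 2 ^ (m - J.card + (C + 1)) := by
    calc 2 ^ m ≤ S.card * 2 ^ C := hS
      _ ≤ 2 * 2 ^ (m - J.card) * 2 ^ C := Nat.mul_le_mul_right _ hS2
      _ = _ := by ring
  have := (Nat.pow_le_pow_iff_right (by norm_num : 1 < 2)).1 hpow
  omega

/-- The sequences of coordinates on which no element of `S` is constantly `b`. -/
def missing {m : ℕ} (s : ℕ) (b : Bool) (S : Finset (Fin m → Bool)) : Finset (Fin s → Fin m) :=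
  univ.filter fun u => ¬ ∃ v ∈ S, ∀ k, v (u k) = b

lemma mem_missing {m s : ℕ} {b : Bool} {S : Finset (Fin m → Bool)} {u : Fin s → Fin m} :
    u ∈ missing s b S ↔ ¬ ∃ v ∈ S, ∀ k, v (u k) = b := by
  rw [missing, mem_filter]; simp

/-- Most sequences of coordinates can be made constantly `b` inside a dense subset of the cube. -/
lemma card_missing_seq_mul_le {m ℓ : ℕ} (hℓ : 2 * m ≤ 2 ^ ℓ) (b : Bool) (s : ℕ) :
    ∀ (C : ℕ) (S : Finset (Fin m → Bool)), 2 ^ m ≤ S.card * 2 ^ C →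
    (missing s b S).card * m
      ≤ s * (C + 1 + s * ℓ) * m ^ s := by
  induction s with
  | zero =>
    intro C S hS
    have : S.Nonempty := by
      rw [← card_pos]
      by_contra h0
      have : S.card = 0 := by omega
      simp [this] at hS
    obtain ⟨v, hv⟩ := this
    have : missing 0 b S = ∅ := by
      refine eq_empty_of_forall_notMem fun u hu => mem_missing.1 hu ⟨v, hv, fun k => k.elim0⟩
    rw [this]; simp
  | succ s ih =>
    intro C S hS
    set J := univ.filter fun j : Fin m => (S.filter fun v => v j = b).card * (2 * m) < S.card
      with hJ
    have hJc := card_dead_le S b hS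
    rw [← hJ] at hJc
    have hcount : (missing (s + 1) b S).card
        = ∑ j : Fin m, (missing s b (S.filter fun v => v j = b)).card := by
      simp only [missing, card_filter]
      rw [← (Fin.consEquiv (fun _ : Fin (s + 1) => Fin m)).sum_comp, Fintype.sum_prod_type]
      refine sum_congr rfl fun j _ => sum_congr rfl fun u _ => ?_
      congr 1
      simp [Fin.forall_fin_succ, Fin.consEquiv, and_assoc]
    rw [hcount, ← sum_filter_add_sum_filter_not univ
      (fun j : Fin m => (S.filter fun v => v j = b).card * (2 * m) < S.card), add_mul, ← hJ]
    have hA : (∑ j ∈ J, (missing s b (S.filter fun v => v j = b)).card) * m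
          ≤ (C + 1) * m ^ (s + 1) := by
      have : ∀ j ∈ J, (missing s b (S.filter fun v => v j = b)).card ≤ m ^ s := fun j _ => by
        refine (card_le_univ _).trans ?_
        simp
      have h2 := sum_le_card_nsmul _ _ _ this
      rw [smul_eq_mul] at h2
      calc _ ≤ J.card * m ^ s * m := Nat.mul_le_mul_right _ h2
        _ ≤ (C + 1) * m ^ s * m := by gcongr
        _ = _ := by ring
    have hB : (∑ j ∈ univ.filter (fun j : Fin m =>
            ¬ (S.filter fun v => v j = b).card * (2 * m) < S.card),
          (missing s b (S.filter fun v => v j = b)).card) * m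
          ≤ m * (s * (C + ℓ + 1 + s * ℓ) * m ^ s) := by
      rw [sum_mul]
      have : ∀ j ∈ univ.filter (fun j : Fin m =>
            ¬ (S.filter fun v => v j = b).card * (2 * m) < S.card),
          (missing s b (S.filter fun v => v j = b)).card * m
            ≤ s * (C + ℓ + 1 + s * ℓ) * m ^ s := fun j hj => by
        refine ih (C + ℓ) _ ?_
        have hj := not_lt.1 (mem_filter.1 hj).2
        calc 2 ^ m ≤ S.card * 2 ^ C := hS
          _ ≤ (S.filter fun v => v j = b).card * (2 * m) * 2 ^ C := Nat.mul_le_mul_right _ hj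
          _ ≤ (S.filter fun v => v j = b).card * 2 ^ ℓ * 2 ^ C := by gcongr
          _ = _ := by ring
      refine (sum_le_card_nsmul _ _ _ this).trans ?_
      rw [smul_eq_mul]
      exact Nat.mul_le_mul_right _ (by simpa using card_le_univ (univ.filter (fun j : Fin m =>
            ¬ (S.filter fun v => v j = b).card * (2 * m) < S.card)))
    calc _ ≤ (C + 1) * m ^ (s + 1) + m * (s * (C + ℓ + 1 + s * ℓ) * m ^ s) := add_le_add hA hB
      _ = (C + 1 + s * (C + 1 + (s + 1) * ℓ)) * m ^ (s + 1) := by ring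
      _ ≤ _ := by
        refine Nat.mul_le_mul_right _ ?_
        nlinarith [Nat.zero_le ((s + 1) * ℓ)]

section Hitting

variable {ι : Type} [Fintype ι] [DecidableEq ι] {m : ℕ}

lemma sum_sum_update {β : Type} [Fintype β] (i : ι) (g : (ι → β) → ℕ) :
    ∑ y : ι → β, ∑ v : β, g (update y i v) = Fintype.card β * ∑ y : ι → β, g y := by
  have hinv : Involutive fun p : (ι → β) × β => (update p.1 i p.2, p.1 i) := fun p => by
    simp
  rw [← Fintype.sum_prod_type' (fun (y : ι → β) (v : β) => g (update y i v)),
    Fintype.sum_equiv hinv.toPerm (fun p : (ι → β) × β => g (update p.1 i p.2))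
      (fun p => g p.1) fun _ => rfl,
    Fintype.sum_prod_type]
  simp [mul_sum]

/-- The `y` whose `i`-th coordinate can be replaced so as to be constantly `b` on `U`, landing
in `B`. -/
def cylOn (i : ι) (b : Bool) (U : Finset (Fin m)) (B : Finset (ι → Fin m → Bool)) :
    Finset (ι → Fin m → Bool) :=
  univ.filter fun y => ∃ v, (∀ α ∈ U, v α = b) ∧ update y i v ∈ B

lemma mem_cylOn {i : ι} {b : Bool} {U : Finset (Fin m)} {B : Finset (ι → Fin m → Bool)}
    {y : ι → Fin m → Bool} :
    y ∈ cylOn i b U B ↔ ∃ v, (∀ α ∈ U, v α = b) ∧ update y i v ∈ B := by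
  rw [cylOn, mem_filter]; simp

/-- The fiber of `B` through `y` in direction `i`. -/
def fibB (i : ι) (B : Finset (ι → Fin m → Bool)) (y : ι → Fin m → Bool) :
    Finset (Fin m → Bool) := univ.filter fun v => update y i v ∈ B

/-- The points whose fiber in `B` has density at least `2 ^ (-(C + 1))`. -/
def rich (i : ι) (C : ℕ) (B : Finset (ι → Fin m → Bool)) : Finset (ι → Fin m → Bool) :=
  univ.filter fun y => 2 ^ m ≤ (fibB i B y).card * 2 ^ (C + 1)

lemma card_le_card_rich (i : ι) (C : ℕ) (B : Finset (ι → Fin m → Bool))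
    (hB : Fintype.card (ι → Fin m → Bool) ≤ B.card * 2 ^ C) :
    Fintype.card (ι → Fin m → Bool) ≤ (rich i C B).card * 2 ^ (C + 1) := by
  set Y := Fintype.card (ι → Fin m → Bool)
  have h1 : ∑ y, (fibB i B y).card = 2 ^ m * B.card := by
    have := sum_sum_update i (fun y : ι → Fin m → Bool => if y ∈ B then 1 else 0)
    simp only [fibB, card_filter]
    rw [this]
    simp
  have h2 : (∑ y, (fibB i B y).card) * 2 ^ (C + 1)
      ≤ ((rich i C B).card * 2 ^ m) * 2 ^ (C + 1) + Y * 2 ^ m := by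
    rw [← sum_filter_add_sum_filter_not univ (fun y => y ∈ rich i C B), add_mul]
    refine add_le_add (Nat.mul_le_mul_right _ ?_) ?_
    · have : ∀ y ∈ univ.filter (fun y => y ∈ rich i C B), (fibB i B y).card ≤ 2 ^ m :=
        fun y _ => (card_le_univ _).trans (by simp)
      refine (sum_le_card_nsmul _ _ _ this).trans (le_of_eq ?_)
      simp
    · rw [sum_mul]
      have : ∀ y ∈ univ.filter (fun y => y ∉ rich i C B),
          (fibB i B y).card * 2 ^ (C + 1) ≤ 2 ^ m := fun y hy => by
        have hy := (mem_filter.1 hy).2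
        rw [rich, mem_filter, not_and] at hy
        exact (not_le.1 (hy (mem_univ _))).le
      refine (sum_le_card_nsmul _ _ _ this).trans ?_
      rw [smul_eq_mul]
      exact Nat.mul_le_mul_right _ (card_le_univ _)
  rw [h1] at h2
  have h3 : 2 ^ m * (2 * Y) ≤ 2 ^ m * ((rich i C B).card * 2 ^ (C + 1) + Y) := by
    calc 2 ^ m * (2 * Y) ≤ 2 ^ m * (2 * (B.card * 2 ^ C)) := by gcongr
      _ = 2 ^ m * B.card * 2 ^ (C + 1) := by ring
      _ ≤ _ := h2
      _ = _ := by ring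
  have := Nat.le_of_mul_le_mul_left h3 (by positivity)
  omega

lemma card_avoiding_le (A : Finset (ι → Fin m)) (i : ι) (τ s : ℕ)
    (hA : ∀ x ∈ A, τ ≤ (fib i A x).card) :
    (univ.filter fun u : Fin s → Fin m => ∃ x ∈ A, ∀ k, u k ∉ fib i A x).card
      ≤ m ^ Fintype.card ι * (m - τ) ^ s := by
  have h1 : (univ.filter fun u : Fin s → Fin m => ∃ x ∈ A, ∀ k, u k ∉ fib i A x)
      ⊆ A.biUnion fun x => Fintype.piFinset fun _ : Fin s => (fib i A x)ᶜ := by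
    intro u hu
    obtain ⟨x, hx, h⟩ := (mem_filter.1 hu).2
    rw [mem_biUnion]
    exact ⟨x, hx, Fintype.mem_piFinset.2 fun k => mem_compl.2 (h k)⟩
  refine (card_le_card h1).trans (card_biUnion_le.trans ?_)
  have h2 : ∀ x ∈ A, (Fintype.piFinset fun _ : Fin s => (fib i A x)ᶜ).card ≤ (m - τ) ^ s := by
    intro x hx
    rw [Fintype.card_piFinset_const, card_compl, Fintype.card_fin]
    exact Nat.pow_le_pow_left (Nat.sub_le_sub_left (hA x hx) m) s
  refine (sum_le_card_nsmul _ _ _ h2).trans ?_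
  rw [smul_eq_mul]
  refine Nat.mul_le_mul_right _ ((card_le_univ A).trans ?_)
  simp

/-- A set of pointers meeting all fibers of a thick `A`, on which many elements of a dense `B` can
be made constant. -/
lemma exists_hitting_set (i : ι) (b : Bool) {s ℓ τ C : ℕ} (hℓ : 2 * m ≤ 2 ^ ℓ) (hm : 0 < m)
    (hsA : 4 * (m ^ Fintype.card ι * (m - τ) ^ s) ≤ m ^ s)
    (hsB : 4 * (s * (C + 2 + s * ℓ)) ≤ m)
    (A : Finset (ι → Fin m)) (hA : ∀ x ∈ A, τ ≤ (fib i A x).card)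
    (B : Finset (ι → Fin m → Bool)) (hB : Fintype.card (ι → Fin m → Bool) ≤ B.card * 2 ^ C) :
    ∃ U : Finset (Fin m), (∀ x ∈ A, ∃ α ∈ U, update x i α ∈ A) ∧
      Fintype.card (ι → Fin m → Bool) ≤ (cylOn i b U B).card * 2 ^ (C + 2) := by
  set G := rich i C B with hG
  have hGc := card_le_card_rich i C B hB
  rw [← hG] at hGc
  have hYpos : 0 < Fintype.card (ι → Fin m → Bool) := Fintype.card_pos
  have hGpos : 0 < G.card := by
    by_contra h
    have : G.card = 0 := by omega
    simp only [this, zero_mul] at hGc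
    omega
  have hms : 0 < m ^ s := by positivity
  have hmiss : ∀ y ∈ G, 4 * (missing s b (fibB i B y)).card ≤ m ^ s := by
    intro y hy
    have h1 := card_missing_seq_mul_le hℓ b s (C + 1) (fibB i B y) (mem_filter.1 hy).2
    have h2 : (4 * (missing s b (fibB i B y)).card) * m ≤ m ^ s * m := by
      calc _ = 4 * ((missing s b (fibB i B y)).card * m) := by ring
        _ ≤ 4 * (s * (C + 1 + 1 + s * ℓ) * m ^ s) := by gcongr
        _ = 4 * (s * (C + 2 + s * ℓ)) * m ^ s := by ring
        _ ≤ m * m ^ s := by gcongr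
        _ = _ := by ring
    exact Nat.le_of_mul_le_mul_right h2 hm
  set bad := univ.filter fun u : Fin s → Fin m => ∃ x ∈ A, ∀ k, u k ∉ fib i A x with hbad
  have hbadc : 4 * bad.card ≤ m ^ s :=
    (Nat.mul_le_mul_left 4 (card_avoiding_le A i τ s hA)).trans hsA
  have hcompl : bad.card + badᶜ.card = m ^ s := by
    rw [card_add_card_compl]; simp
  let F : (Fin s → Fin m) → Finset (ι → Fin m → Bool) :=
    fun u => G.filter fun y => u ∈ missing s b (fibB i B y)
  have hsum : 4 * ∑ u ∈ badᶜ, (F u).card ≤ G.card * m ^ s := by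
    have h1 : ∑ u ∈ badᶜ, (F u).card ≤ ∑ u, (F u).card :=
      sum_le_sum_of_subset (subset_univ _)
    have h2 : ∑ u, (F u).card = ∑ y ∈ G, (missing s b (fibB i B y)).card := by
      simp only [F, card_filter]
      rw [sum_comm]
      refine sum_congr rfl fun y _ => ?_
      simp
    have h3 : ∑ y ∈ G, 4 * (missing s b (fibB i B y)).card ≤ G.card * m ^ s := by
      simpa using sum_le_card_nsmul _ _ _ hmiss
    rw [← mul_sum] at h3
    omega
  obtain ⟨u, hu, hFu⟩ : ∃ u ∈ badᶜ, 2 * (F u).card ≤ G.card := by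
    by_contra! hcon
    have h1 : badᶜ.card * G.card ≤ ∑ u ∈ badᶜ, 2 * (F u).card := by
      simpa using card_nsmul_le_sum _ _ _ fun u hu => (hcon u hu).le
    rw [← mul_sum] at h1
    have h2 : 3 * m ^ s ≤ 4 * badᶜ.card := by omega
    nlinarith
  refine ⟨univ.image u, fun x hx => ?_, ?_⟩
  · by_contra! hcon
    refine (mem_compl.1 hu) (mem_filter.2 ⟨mem_univ _, x, hx, fun k hk => ?_⟩)
    exact hcon (u k) (mem_image_of_mem _ (mem_univ k)) (mem_fib.1 hk)
  · have hsub : G \ F u ⊆ cylOn i b (univ.image u) B := by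
      intro y hy
      rw [mem_sdiff, mem_filter, not_and] at hy
      have h := hy.2 hy.1
      rw [mem_missing, not_not] at h
      obtain ⟨v, hv, hvb⟩ := h
      refine mem_cylOn.2 ⟨v, ?_, (mem_filter.1 hv).2⟩
      intro α hα
      obtain ⟨k, -, rfl⟩ := mem_image.1 hα
      exact hvb k
    have h1 := card_le_card hsub
    have h2 := card_sdiff_add_card_eq_card (filter_subset (fun y => u ∈ missing s b (fibB i B y)) G)
    have h3 : G.card ≤ 2 * (cylOn i b (univ.image u) B).card := by
      simp only [F] at h1 hFu
      omega
    calc _ ≤ G.card * 2 ^ (C + 1) := hGc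
      _ ≤ 2 * (cylOn i b (univ.image u) B).card * 2 ^ (C + 1) := Nat.mul_le_mul_right _ h3
      _ = _ := by ring

end Hitting

/-! ### Query adversaries and the simulation theorem -/

/-- The input `z` extends the partial assignment `ρ`. -/
def Extends {ι : Type} (z : ι → Bool) (ρ : ι → Option Bool) : Prop :=
  ∀ i b, ρ i = some b → z i = b

/-- An adversary can answer queries extending `ρ` so that `f` stays undetermined during the first
`d` queries. -/
def Adversary {ι : Type} [DecidableEq ι] (f : (ι → Bool) → Bool) : ℕ → (ι → Option Bool) → Prop
  | 0, _ => True
  | d + 1, ρ => (∀ b, ∃ z, Extends z ρ ∧ f z = b) ∧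
      ∀ i, ρ i = none → ∃ b, Adversary f d (update ρ i (some b))

/-- The composition of `f` with the index gadget. -/
def indexed {ι : Type} {m : ℕ} (f : (ι → Bool) → Bool) (x : ι → Fin m) (y : ι → Fin m → Bool) :
    Bool :=
  f fun i => y i (x i)

section Simulation

variable {ι : Type} [Fintype ι] [DecidableEq ι] {m : ℕ}

/-- The coordinates left free by `ρ`. -/
def free (ρ : ι → Option Bool) : Finset ι := univ.filter fun i => ρ i = none

lemma mem_free {ρ : ι → Option Bool} {i : ι} : i ∈ free ρ ↔ ρ i = none := by simp [free]

lemma free_update (ρ : ι → Option Bool) (i : ι) (b : Bool) :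
    free (update ρ i (some b)) = (free ρ).erase i := by
  ext j
  rw [mem_free, mem_erase, mem_free]
  by_cases h : j = i <;> simp [h]

/-- The rectangle `A × B` embeds into the inputs on which `P` computes `f` composed with the index
gadget, in such a way that gadgets fixed by `ρ` have the prescribed value and the free gadgets are
unaffected. -/
def Simulates (f : (ι → Bool) → Bool) (P : Protocol (ι → Fin m) (ι → Fin m → Bool))
    (ρ : ι → Option Bool) (A : Finset (ι → Fin m)) (B : Finset (ι → Fin m → Bool)) : Prop :=
  ∃ (p : (ι → Fin m) → ι → Fin m) (q : (ι → Fin m → Bool) → ι → Fin m → Bool),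
    ∀ x ∈ A, ∀ y ∈ B, Extends (fun j => q y j (p x j)) ρ ∧
      (∀ j, ρ j = none → q y j (p x j) = y j (x j)) ∧ P.eval (p x) (q y) = indexed f (p x) (q y)

lemma Simulates.mono {f : (ι → Bool) → Bool} {P : Protocol (ι → Fin m) (ι → Fin m → Bool)}
    {ρ : ι → Option Bool} {A A' : Finset (ι → Fin m)} {B B' : Finset (ι → Fin m → Bool)}
    (h : Simulates f P ρ A B) (hA : A' ⊆ A) (hB : B' ⊆ B) : Simulates f P ρ A' B' := by
  obtain ⟨p, q, h⟩ := h
  exact ⟨p, q, fun x hx y hy => h x (hA hx) y (hB hy)⟩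

lemma exists_half {α : Type} (A : Finset α) (g : α → Bool) :
    ∃ c, A.card ≤ 2 * (A.filter fun x => g x = c).card := by
  have h := card_filter_add_card_filter_not (s := A) (fun x => g x = true)
  simp only [Bool.not_eq_true] at h
  by_contra! hc
  have h1 := hc true
  have h2 := hc false
  omega

lemma Simulates.nodeA {f : (ι → Bool) → Bool} {g : (ι → Fin m) → Bool}
    {P₀ P₁ : Protocol (ι → Fin m) (ι → Fin m → Bool)} {ρ : ι → Option Bool}
    {A : Finset (ι → Fin m)} {B : Finset (ι → Fin m → Bool)}
    (h : Simulates f (.nodeA g P₀ P₁) ρ A B) :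
    ∃ (c : Bool) (A' : Finset (ι → Fin m)), A' ⊆ A ∧ A.card ≤ 2 * A'.card ∧
      Simulates f (if c then P₁ else P₀) ρ A' B := by
  obtain ⟨p, q, h⟩ := h
  obtain ⟨c, hc⟩ := exists_half A fun x => g (p x)
  refine ⟨c, _, filter_subset _ _, hc, p, q, fun x hx y hy => ?_⟩
  rw [mem_filter] at hx
  obtain ⟨h1, h2, h3⟩ := h x hx.1 y hy
  refine ⟨h1, h2, ?_⟩
  rw [← h3, Protocol.eval, hx.2]
  cases c <;> simp

lemma Simulates.nodeB {f : (ι → Bool) → Bool} {g : (ι → Fin m → Bool) → Bool}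
    {P₀ P₁ : Protocol (ι → Fin m) (ι → Fin m → Bool)} {ρ : ι → Option Bool}
    {A : Finset (ι → Fin m)} {B : Finset (ι → Fin m → Bool)}
    (h : Simulates f (.nodeB g P₀ P₁) ρ A B) :
    ∃ (c : Bool) (B' : Finset (ι → Fin m → Bool)), B' ⊆ B ∧ B.card ≤ 2 * B'.card ∧
      Simulates f (if c then P₁ else P₀) ρ A B' := by
  obtain ⟨p, q, h⟩ := h
  obtain ⟨c, hc⟩ := exists_half B fun y => g (q y)
  refine ⟨c, _, filter_subset _ _, hc, p, q, fun x hx y hy => ?_⟩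
  rw [mem_filter] at hy
  obtain ⟨h1, h2, h3⟩ := h x hx y hy.1
  refine ⟨h1, h2, ?_⟩
  rw [← h3, Protocol.eval, hy.2]
  cases c <;> simp

lemma Simulates.fix {f : (ι → Bool) → Bool} {P : Protocol (ι → Fin m) (ι → Fin m → Bool)}
    {ρ : ι → Option Bool} {A : Finset (ι → Fin m)} {B : Finset (ι → Fin m → Bool)}
    (h : Simulates f P ρ A B) {i : ι} (hi : ρ i = none) (b : Bool) {U : Finset (Fin m)}
    (hU : ∀ x ∈ A, ∃ α ∈ U, update x i α ∈ A) :
    Simulates f P (update ρ i (some b)) (cyl i A) (cylOn i b U B) := by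
  obtain ⟨p, q, h⟩ := h
  have hx : ∀ x, ∃ α, x ∈ cyl i A → α ∈ U ∧ update x i α ∈ A := by
    intro x
    by_cases hx : x ∈ cyl i A
    · obtain ⟨β, hβ⟩ := mem_cyl.1 hx
      obtain ⟨α, hα, hA⟩ := hU _ hβ
      exact ⟨α, fun _ => ⟨hα, by simpa using hA⟩⟩
    · exact ⟨x i, fun h => absurd h hx⟩
  have hy : ∀ y, ∃ v, y ∈ cylOn i b U B → (∀ α ∈ U, v α = b) ∧ update y i v ∈ B := by
    intro y
    by_cases hy : y ∈ cylOn i b U B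
    · obtain ⟨v, hv⟩ := mem_cylOn.1 hy
      exact ⟨v, fun _ => hv⟩
    · exact ⟨y i, fun h => absurd h hy⟩
  choose α hα using hx
  choose v hv using hy
  refine ⟨fun x => p (update x i (α x)), fun y => q (update y i (v y)), fun x hxA y hyB => ?_⟩
  obtain ⟨hαU, hxA⟩ := hα x hxA
  obtain ⟨hvU, hyB⟩ := hv y hyB
  obtain ⟨h1, h2, h3⟩ := h _ hxA _ hyB
  refine ⟨?_, ?_, h3⟩
  · intro j c hj
    by_cases hji : j = i
    · subst hji
      have := h2 j hi
      simp only [update_self] at this hj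
      refine this.trans ?_
      rw [hvU _ hαU]
      simpa using hj
    · rw [update_of_ne hji] at hj
      exact h1 j c hj
  · intro j hj
    by_cases hji : j = i
    · subst hji; simp at hj
    · rw [update_of_ne hji] at hj
      have := h2 j hj
      rwa [update_of_ne hji, update_of_ne hji] at this

/-- Numerical conditions on the gadget size `m` under which the simulation works for `N` gadgets
and density exponents up to `C`. -/
structure GadgetParams (N m τ s ℓ C : ℕ) : Prop where
  pos : 0 < m
  log : 2 * m ≤ 2 ^ ℓ
  thick : 16 * (τ * N) ≤ m
  hitA : 4 * (m ^ N * (m - τ) ^ s) ≤ m ^ s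
  hitB : 4 * (s * (C + 2 + s * ℓ)) ≤ m

variable {τ s ℓ K : ℕ}

lemma Simulates.exists_fix (hp : GadgetParams (Fintype.card ι) m τ s ℓ K)
    {f : (ι → Bool) → Bool} {P : Protocol (ι → Fin m) (ι → Fin m → Bool)}
    {ρ : ι → Option Bool} {A : Finset (ι → Fin m)} {B : Finset (ι → Fin m → Bool)} {C : ℕ}
    (h : Simulates f P ρ A B) (hA : Thick (free ρ) τ A)
    (hB : Fintype.card (ι → Fin m → Bool) ≤ B.card * 2 ^ C) (hC : C ≤ K)
    {i : ι} (hi : ρ i = none) (b : Bool) :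
    ∃ B' : Finset (ι → Fin m → Bool), Simulates f P (update ρ i (some b)) (cyl i A) B' ∧
      Fintype.card (ι → Fin m → Bool) ≤ B'.card * 2 ^ (C + 2) := by
  have hsB : 4 * (s * (C + 2 + s * ℓ)) ≤ m := le_trans (by gcongr) hp.hitB
  obtain ⟨U, hU, hB'⟩ := exists_hitting_set i b hp.log hp.pos hp.hitA hsB A
    (fun x hx => hA x hx i (mem_free.2 hi)) B hB
  exact ⟨_, h.fix hi b hU, hB'⟩

lemma nonempty_of_dense {B : Finset (ι → Fin m → Bool)} {C : ℕ}
    (hB : Fintype.card (ι → Fin m → Bool) ≤ B.card * 2 ^ C) : B.Nonempty := by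
  rw [← card_pos]
  by_contra h
  have h0 : B.card = 0 := by omega
  have : 0 < Fintype.card (ι → Fin m → Bool) := Fintype.card_pos
  rw [h0] at hB
  omega

lemma Simulates.leaf_eq (hp : GadgetParams (Fintype.card ι) m τ s ℓ K)
    {f : (ι → Bool) → Bool} {c : Bool} (n : ℕ) :
    ∀ {C : ℕ} {ρ : ι → Option Bool} {A : Finset (ι → Fin m)} {B : Finset (ι → Fin m → Bool)},
      (free ρ).card = n → Simulates f (.leaf c) ρ A B → A.Nonempty → Thick (free ρ) τ A →
      Fintype.card (ι → Fin m → Bool) ≤ B.card * 2 ^ C → C + 2 * n ≤ K →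
      ∀ z, Extends z ρ → f z = c := by
  induction n with
  | zero =>
    intro C ρ A B hn h hA hT hB hC z hz
    obtain ⟨x, hx⟩ := hA
    obtain ⟨y, hy⟩ := nonempty_of_dense hB
    obtain ⟨p, q, h⟩ := h
    obtain ⟨h1, -, h3⟩ := h x hx y hy
    rw [Protocol.eval, indexed] at h3
    rw [h3]
    congr 1
    funext j
    rw [card_eq_zero] at hn
    obtain ⟨b, hb⟩ : ∃ b, ρ j = some b := by
      rw [← Option.ne_none_iff_exists']
      intro hj
      have := mem_free.2 hj
      simp [hn] at this
    rw [hz j b hb]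
    exact (h1 j b hb).symm
  | succ n ih =>
    intro C ρ A B hn h hA hT hB hC z hz
    obtain ⟨i, hi⟩ : (free ρ).Nonempty := by rw [← card_pos]; omega
    have hi' := mem_free.1 hi
    obtain ⟨B', h', hB'⟩ := h.exists_fix hp hT hB (by omega) hi' (z i)
    refine ih (ρ := update ρ i (some (z i))) ?_ h' (hA.mono (subset_cyl i A)) ?_ hB' (by omega)
      z ?_
    · rw [free_update, card_erase_of_mem hi, hn]; rfl
    · rw [free_update]; exact hT.cyl i
    · intro j b hj
      by_cases hji : j = i
      · subst hji; simpa using hj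
      · rw [update_of_ne hji] at hj; exact hz j b hj

/-- The invariant of the simulation: `A × B` is a large rectangle reaching the protocol `P`, and
the adversary for `f` survives `d` more queries from `ρ`. -/
structure SimState (τ K : ℕ) (f : (ι → Bool) → Bool)
    (P : Protocol (ι → Fin m) (ι → Fin m → Bool)) (d e : ℕ) (ρ : ι → Option Bool)
    (A : Finset (ι → Fin m)) (B : Finset (ι → Fin m → Bool)) (C : ℕ) : Prop where
  simulates : Simulates f P ρ A B
  nonempty : A.Nonempty
  thick : Thick (free ρ) τ A
  adversary : Adversary f d ρ
  denseA : m ^ Fintype.card ι ≤ A.card * 4 ^ e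
  denseB : Fintype.card (ι → Fin m → Bool) ≤ B.card * 2 ^ C
  budget : C + P.depth + 2 * (free ρ).card ≤ K

lemma SimState.le_of_forall_balanced (hp : GadgetParams (Fintype.card ι) m τ s ℓ K)
    {f : (ι → Bool) → Bool} {P : Protocol (ι → Fin m) (ι → Fin m → Bool)}
    (hbal : ∀ d e ρ A B C, SimState τ K f P d e ρ A B C →
      (∀ i ∈ free ρ, (cyl i A).card ≤ 4 * A.card) → d ≤ P.depth + e) (e : ℕ) :
    ∀ d ρ A B C, SimState τ K f P d e ρ A B C → d ≤ P.depth + e := by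
  induction e with
  | zero =>
    intro d ρ A B C h
    refine hbal d 0 ρ A B C h fun i _ => ?_
    have h1 : (cyl i A).card ≤ m ^ Fintype.card ι := (card_le_univ _).trans (by simp)
    have h2 := h.denseA
    omega
  | succ e ih =>
    intro d ρ A B C h
    by_cases hb : ∀ i ∈ free ρ, (cyl i A).card ≤ 4 * A.card
    · exact hbal d _ ρ A B C h hb
    push Not at hb
    obtain ⟨i, hi, hlt⟩ := hb
    rcases d with _ | d
    · omega
    have hi' := mem_free.1 hi
    have hbud := h.budget
    obtain ⟨b, hadv⟩ := h.adversary.2 i hi'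
    obtain ⟨B', h', hB'⟩ := h.simulates.exists_fix hp h.thick h.denseB (by omega) hi' b
    have hpos : 0 < (free ρ).card := card_pos.2 ⟨i, hi⟩
    have := ih d _ _ _ _ {
      simulates := h'
      nonempty := h.nonempty.mono (subset_cyl i A)
      thick := by rw [free_update]; exact h.thick.cyl i
      adversary := hadv
      denseA := by
        calc _ ≤ A.card * 4 ^ (e + 1) := h.denseA
          _ = 4 * A.card * 4 ^ e := by ring
          _ ≤ _ := Nat.mul_le_mul_right _ hlt.le
      denseB := hB'
      budget := by rw [free_update, card_erase_of_mem hi]; omega }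
    omega

lemma depth_ite_lt {X Y : Type} (c : Bool) (P₀ P₁ : Protocol X Y) :
    (if c then P₁ else P₀).depth + 1 ≤ 1 + max P₀.depth P₁.depth := by
  cases c <;> simp <;> omega

theorem SimState.le_depth_add (hp : GadgetParams (Fintype.card ι) m τ s ℓ K)
    {f : (ι → Bool) → Bool} (P : Protocol (ι → Fin m) (ι → Fin m → Bool)) :
    ∀ e d ρ A B C, SimState τ K f P d e ρ A B C → d ≤ P.depth + e := by
  induction P with
  | leaf c =>
    intro e
    refine SimState.le_of_forall_balanced hp (fun d e ρ A B C h _ => ?_) e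
    rcases d with _ | d
    · omega
    obtain ⟨z, hz, hfz⟩ := h.adversary.1 (!c)
    have hb := h.budget
    have := h.simulates.leaf_eq hp _ rfl h.nonempty h.thick h.denseB (by omega) z hz
    rw [hfz] at this
    simp at this
  | nodeA g P₀ P₁ ih₀ ih₁ =>
    intro e
    refine SimState.le_of_forall_balanced hp (fun d e ρ A B C h hbal => ?_) e
    obtain ⟨c, A', hA', hc, hs⟩ := h.simulates.nodeA
    obtain ⟨A₂, hA₂, hc', hT⟩ := exists_thick_subset (free ρ) τ A' hp.pos (by
      have h1 : ∑ i ∈ free ρ, (cyl i A').card ≤ Fintype.card ι * (8 * A'.card) := by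
        have : ∀ i ∈ free ρ, (cyl i A').card ≤ 8 * A'.card := fun i hi => by
          have := card_le_card (cyl_mono i hA')
          have := hbal i hi
          omega
        refine (sum_le_card_nsmul _ _ _ this).trans ?_
        rw [smul_eq_mul]
        exact Nat.mul_le_mul_right _ (card_le_univ _)
      calc _ ≤ 2 * (τ * (Fintype.card ι * (8 * A'.card))) := by gcongr
        _ = 16 * (τ * Fintype.card ι) * A'.card := by ring
        _ ≤ _ := Nat.mul_le_mul_right _ hp.thick)
    have hd := depth_ite_lt c P₀ P₁
    have hpos := card_pos.2 h.nonempty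
    have hbud := h.budget
    simp only [Protocol.depth] at hbud ⊢
    have hst : SimState τ K f (if c then P₁ else P₀) d (e + 1) ρ A₂ B C :=
      { simulates := hs.mono hA₂ subset_rfl
        nonempty := card_pos.1 (by omega)
        thick := hT
        adversary := h.adversary
        denseA := by
          calc _ ≤ A.card * 4 ^ e := h.denseA
            _ ≤ (4 * A₂.card) * 4 ^ e := Nat.mul_le_mul_right _ (by omega)
            _ = _ := by ring
        denseB := h.denseB
        budget := by omega }
    have : d ≤ (if c then P₁ else P₀).depth + (e + 1) := by
      cases c
      · exact ih₀ _ _ _ _ _ _ hst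
      · exact ih₁ _ _ _ _ _ _ hst
    omega
  | nodeB g P₀ P₁ ih₀ ih₁ =>
    intro e
    refine SimState.le_of_forall_balanced hp (fun d e ρ A B C h _ => ?_) e
    obtain ⟨c, B', hB', hc, hs⟩ := h.simulates.nodeB
    have hd := depth_ite_lt c P₀ P₁
    have hbud := h.budget
    simp only [Protocol.depth] at hbud ⊢
    have hst : SimState τ K f (if c then P₁ else P₀) d e ρ A B' (C + 1) :=
      { simulates := hs
        nonempty := h.nonempty
        thick := h.thick
        adversary := h.adversary
        denseA := h.denseA
        denseB := by
          calc _ ≤ B.card * 2 ^ C := h.denseB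
            _ ≤ (2 * B'.card) * 2 ^ C := Nat.mul_le_mul_right _ hc
            _ = _ := by ring
        budget := by omega }
    have : d ≤ (if c then P₁ else P₀).depth + e := by
      cases c
      · exact ih₀ _ _ _ _ _ _ hst
      · exact ih₁ _ _ _ _ _ _ hst
    omega

/-- Query lower bounds lift to communication lower bounds through the index gadget. -/
theorem le_depth_of_adversary (d : ℕ)
    (hp : GadgetParams (Fintype.card ι) m τ s ℓ (d + 2 * Fintype.card ι))
    {f : (ι → Bool) → Bool} (hf : Adversary f d fun _ => none)
    (P : Protocol (ι → Fin m) (ι → Fin m → Bool)) (hP : ∀ x y, P.eval x y = indexed f x y) :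
    d ≤ P.depth := by
  by_contra! hlt
  have hm := hp.pos
  have : Nonempty (Fin m) := ⟨⟨0, hm⟩⟩
  have := SimState.le_depth_add hp P 0 d (fun _ => none) univ univ 0
    { simulates := ⟨id, id, fun x _ y _ => ⟨fun j b h => by simp at h, fun _ _ => rfl, hP x y⟩⟩
      nonempty := univ_nonempty
      thick := fun x _ i _ => by
        have h1 : fib i univ x = univ := by simp [fib]
        rw [h1, card_univ, Fintype.card_fin]
        have : 0 < Fintype.card ι := Fintype.card_pos_iff.2 ⟨i⟩
        have h2 := hp.thick
        nlinarith
      adversary := hf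
      denseA := by simp
      denseB := by simp
      budget := by
        have : (free fun _ : ι => (none : Option Bool)).card ≤ Fintype.card ι := card_le_univ _
        omega }
  omega

end Simulation

/-! ### Query complexity measures -/

section Query

variable {ι : Type} [DecidableEq ι]

/-- Every input with value `b` has a certificate of size at most `w`. -/
def HasCert (f : (ι → Bool) → Bool) (b : Bool) (w : ℕ) : Prop :=
  ∀ z, f z = b → ∃ T : Finset ι, T.card ≤ w ∧ ∀ z', (∀ i ∈ T, z' i = z i) → f z' = b

/-- `S` assigns to every input the domain of the unique certificate containing it, in a partition
of the cube into subcubes on which `f` is constant. -/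
def IsUnambiguous (f : (ι → Bool) → Bool) (S : (ι → Bool) → Finset ι) : Prop :=
  ∀ z z', (∀ i ∈ S z, z' i = z i) → S z' = S z ∧ f z' = f z

/-- `f` has unambiguous certificates of size at most `v` on `1`-inputs and `u` on `0`-inputs. -/
def HasUnambiguousCert (f : (ι → Bool) → Bool) (v u : ℕ) : Prop :=
  ∃ S, IsUnambiguous f S ∧ ∀ z, (S z).card ≤ if f z then v else u

lemma HasUnambiguousCert.hasCert_true {f : (ι → Bool) → Bool} {v u : ℕ}
    (h : HasUnambiguousCert f v u) : HasCert f true v := by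
  obtain ⟨S, hS, hc⟩ := h
  intro z hz
  exact ⟨S z, by simpa [hz] using hc z, fun z' hz' => by rw [(hS z z' hz').2, hz]⟩

lemma HasCert.mono {f : (ι → Bool) → Bool} {b : Bool} {w w' : ℕ} (h : HasCert f b w)
    (hw : w ≤ w') : HasCert f b w' := fun z hz => by
  obtain ⟨T, hT, h⟩ := h z hz
  exact ⟨T, hT.trans hw, h⟩

lemma Adversary.mono {f : (ι → Bool) → Bool} {d d' : ℕ} (h : d' ≤ d) :
    ∀ {ρ}, Adversary f d ρ → Adversary f d' ρ := by
  induction d' generalizing d with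
  | zero => intro ρ _; trivial
  | succ d' ih =>
    intro ρ hρ
    obtain ⟨d, rfl⟩ : ∃ k, d = k + 1 := ⟨d - 1, by omega⟩
    refine ⟨hρ.1, fun i hi => ?_⟩
    obtain ⟨b, hb⟩ := hρ.2 i hi
    exact ⟨b, ih (by omega) hb⟩

/-! ### The function `nand` composed with `f` -/

/-- The negated conjunction of `n` copies of `f` on disjoint inputs. -/
def nandComp (n : ℕ) (f : (ι → Bool) → Bool) (z : Fin n × ι → Bool) : Bool :=
  !decide (∀ j, f (fun i => z (j, i)) = true)

variable {n : ℕ} {f : (ι → Bool) → Bool}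

lemma nandComp_eq_false {z : Fin n × ι → Bool} :
    nandComp n f z = false ↔ ∀ j, f (fun i => z (j, i)) = true := by
  simp [nandComp]

lemma nandComp_eq_true {z : Fin n × ι → Bool} :
    nandComp n f z = true ↔ ∃ j, f (fun i => z (j, i)) = false := by
  simp [nandComp]

lemma nandComp_congr {z z' : Fin n × ι → Bool}
    (h : ∀ j, f (fun i => z' (j, i)) = f (fun i => z (j, i))) :
    nandComp n f z' = nandComp n f z := by
  simp [nandComp, h]

lemma card_biUnion_copies_le {α : Type} [DecidableEq α] (s : Finset α)
    (T : α → Finset ι) (w : ℕ) (h : ∀ j ∈ s, (T j).card ≤ w) :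
    (s.biUnion fun j => (T j).image (Prod.mk j)).card ≤ s.card * w :=
  card_biUnion_le_card_mul _ _ _ fun j hj => card_image_le.trans (h j hj)

lemma mem_copies {α : Type} [DecidableEq α] {s : Finset α}
    {T : α → Finset ι} {j : α} {i : ι} :
    (j, i) ∈ (s.biUnion fun j => (T j).image (Prod.mk j)) ↔ j ∈ s ∧ i ∈ T j := by
  simp only [mem_biUnion, mem_image, Prod.mk.injEq]
  constructor
  · rintro ⟨a, ha, b, hb, rfl, rfl⟩; exact ⟨ha, hb⟩
  · rintro ⟨h1, h2⟩; exact ⟨j, h1, i, h2, rfl, rfl⟩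

lemma HasCert.nandComp_true {w : ℕ} (h : HasCert f false w) : HasCert (nandComp n f) true w := by
  intro z hz
  obtain ⟨j, hj⟩ := nandComp_eq_true.1 hz
  obtain ⟨T, hT, hc⟩ := h _ hj
  refine ⟨T.image (Prod.mk j), card_image_le.trans hT, fun z' hz' => ?_⟩
  exact nandComp_eq_true.2 ⟨j, hc _ fun i hi => hz' _ (mem_image_of_mem _ hi)⟩

lemma HasCert.nandComp_false {w : ℕ} (h : HasCert f true w) :
    HasCert (nandComp n f) false (n * w) := by
  intro z hz
  rw [nandComp_eq_false] at hz
  choose T hT hc using fun j => h _ (hz j)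
  refine ⟨univ.biUnion fun j => (T j).image (Prod.mk j), ?_, fun z' hz' => ?_⟩
  · simpa using card_biUnion_copies_le univ T w fun j _ => hT j
  · exact nandComp_eq_false.2 fun j => hc j _ fun i hi =>
      hz' _ (mem_copies.2 ⟨mem_univ j, hi⟩)

/-- Taking the certificates of all copies. -/
lemma HasUnambiguousCert.nandComp_all {w : ℕ} (h : HasUnambiguousCert f w w) :
    HasUnambiguousCert (nandComp n f) (n * w) (n * w) := by
  obtain ⟨S, hS, hc⟩ := h
  simp only [ite_self] at hc
  refine ⟨fun z => univ.biUnion fun j => (S fun i => z (j, i)).image (Prod.mk j), ?_, ?_⟩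
  · intro z z' hz
    have h1 := fun j => hS (fun i => z (j, i)) (fun i => z' (j, i)) fun i hi =>
      hz (j, i) (mem_copies.2 ⟨mem_univ j, hi⟩)
    refine ⟨?_, nandComp_congr fun j => (h1 j).2⟩
    simp only [(h1 _).1]
  · intro z
    simp only [ite_self]
    simpa using card_biUnion_copies_le univ (fun j => S fun i => z (j, i)) w fun j _ => hc _

/-- Scanning the copies in order up to the first one with value `false`. -/
lemma HasUnambiguousCert.nandComp_scan {v u : ℕ} (h : HasUnambiguousCert f v u) :
    HasUnambiguousCert (nandComp n f) (n * v + u) (n * v + u) := by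
  obtain ⟨S, hS, hc⟩ := h
  let vis : (Fin n × ι → Bool) → Finset (Fin n) := fun z =>
    univ.filter fun j => ∀ k < j, f (fun i => z (k, i)) = true
  have hvis : ∀ z j, j ∈ vis z ↔ ∀ k < j, f (fun i => z (k, i)) = true := by simp [vis]
  refine ⟨fun z => (vis z).biUnion fun j => (S fun i => z (j, i)).image (Prod.mk j), ?_, ?_⟩
  · intro z z' hz
    have h1 := fun j (hj : j ∈ vis z) => hS (fun i => z (j, i)) (fun i => z' (j, i)) fun i hi =>
      hz (j, i) (mem_copies.2 ⟨hj, hi⟩)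
    have hv : vis z' = vis z := by
      ext j
      constructor
      · intro hj
        rw [hvis] at hj ⊢
        intro k hk
        induction k using WellFoundedLT.induction with
        | _ k ih =>
        have hkv : k ∈ vis z := (hvis z k).2 fun l hl => ih l hl (hl.trans hk)
        rw [← (h1 k hkv).2]
        exact hj k hk
      · intro hj
        rw [hvis]
        intro k hk
        have hkv : k ∈ vis z := (hvis z k).2 fun l hl => (hvis z j).1 hj l (hl.trans hk)
        rw [(h1 k hkv).2]
        exact (hvis z j).1 hj k hk
    refine ⟨?_, ?_⟩
    · simp only [hv]
      exact biUnion_congr rfl fun j hj => by rw [(h1 j hj).1]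
    · cases hb : nandComp n f z
      · rw [nandComp_eq_false] at hb ⊢
        intro j
        rw [(h1 j ((hvis z j).2 fun k _ => hb k)).2, hb j]
      · rw [nandComp_eq_true] at hb ⊢
        obtain ⟨j, hj, hmin⟩ := WellFounded.has_min (wellFounded_lt (α := Fin n))
          {j | f (fun i => z (j, i)) = false} hb
        refine ⟨j, (h1 j ((hvis z j).2 fun k hk => ?_)).2.trans hj⟩
        by_contra hcon
        exact hmin k (Bool.eq_false_iff.2 hcon) hk
  · intro z
    simp only [ite_self]
    calc _ ≤ ∑ j ∈ vis z, ((S fun i => z (j, i)).image (Prod.mk j)).card := card_biUnion_le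
      _ ≤ ∑ j ∈ vis z, if f (fun i => z (j, i)) = true then v else u :=
        sum_le_sum fun j _ => card_image_le.trans (hc _)
      _ = ((vis z).filter fun j => f (fun i => z (j, i)) = true).card * v +
          ((vis z).filter fun j => ¬ f (fun i => z (j, i)) = true).card * u := by
        rw [sum_ite, sum_const, sum_const, smul_eq_mul, smul_eq_mul]
      _ ≤ n * v + 1 * u := by
        gcongr
        · exact (card_le_univ _).trans_eq (Fintype.card_fin n)
        · refine card_le_one.2 fun a ha b hb => ?_
          rw [mem_filter, hvis] at ha hb
          rcases lt_trichotomy a b with h | h | h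
          · exact absurd (hb.1 a h) ha.2
          · exact h
          · exact absurd (ha.1 b h) hb.2
      _ = n * v + u := by rw [one_mul]

lemma Adversary.nandComp_of_budget {f : (ι → Bool) → Bool} (d : ℕ) :
    ∀ (D : Fin n → ℕ) (ρ : Fin n × ι → Option Bool), d ≤ ∑ j, D j →
      (∀ j, Adversary f (D j) fun i => ρ (j, i)) →
      (∀ j, ∃ z, Extends z (fun i => ρ (j, i)) ∧ f z = true) →
      Adversary (nandComp n f) d ρ := by
  induction d with
  | zero => intros; trivial
  | succ d ih =>
    intro D ρ hd hA hT
    have hcur : ∀ j i (b : Bool), (fun i' => update ρ (j, i) (some b) (j, i'))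
        = update (fun i' => ρ (j, i')) i (some b) := by
      intro j i b
      funext i'
      by_cases h : i' = i
      · subst h; simp
      · rw [update_of_ne h, update_of_ne (by simpa using h)]
    have hoth : ∀ j i (b : Bool) j', j' ≠ j → (fun i' => update ρ (j, i) (some b) (j', i'))
        = fun i' => ρ (j', i') := by
      intro j i b j' h
      funext i'
      rw [update_of_ne (by simp [h])]
    choose z hz hzf using hT
    constructor
    · rintro (_ | _)
      · exact ⟨fun p => z p.1 p.2, fun p b hp => hz p.1 p.2 b hp, nandComp_eq_false.2 hzf⟩
      · obtain ⟨j, -, hj⟩ : ∃ j ∈ univ, D j ≠ 0 := by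
          by_contra! hcon
          rw [sum_eq_zero hcon] at hd
          omega
        obtain ⟨k, hk⟩ := Nat.exists_eq_succ_of_ne_zero hj
        have := hA j
        rw [hk] at this
        obtain ⟨w, hw, hwf⟩ := this.1 false
        refine ⟨fun p => if p.1 = j then w p.2 else z p.1 p.2, ?_,
          nandComp_eq_true.2 ⟨j, by simpa using hwf⟩⟩
        rintro ⟨a, i⟩ b hp
        by_cases ha : a = j
        · subst ha; simpa using hw i b hp
        · simpa [ha] using hz a i b hp
    · rintro ⟨j, i⟩ hji
      obtain ⟨b, hb1, hb2⟩ : ∃ b, Adversary f (D j - 1) (update (fun i' => ρ (j, i')) i (some b)) ∧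
          ∃ z, Extends z (update (fun i' => ρ (j, i')) i (some b)) ∧ f z = true := by
        rcases Nat.lt_or_ge (D j) 2 with h2 | h2
        · refine ⟨z j i, ?_, z j, ?_, hzf j⟩
          · have : D j - 1 = 0 := by omega
            rw [this]; trivial
          · intro i' b' h
            by_cases hi : i' = i
            · subst hi; simpa using h
            · rw [update_of_ne hi] at h; exact hz j i' b' h
        · obtain ⟨k, hk⟩ : ∃ k, D j = k + 2 := ⟨D j - 2, by omega⟩
          have := hA j
          rw [hk] at this
          obtain ⟨b, hb⟩ := this.2 i hji
          refine ⟨b, by rw [hk]; exact hb, hb.1 true⟩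
      refine ⟨b, ih (update D j (D j - 1)) _ ?_ ?_ ?_⟩
      · have h1 := add_sum_erase univ D (mem_univ j)
        have h2 := add_sum_erase univ (update D j (D j - 1)) (mem_univ j)
        have h3 : ∑ k ∈ univ.erase j, update D j (D j - 1) k = ∑ k ∈ univ.erase j, D k :=
          sum_congr rfl fun k hk => update_of_ne (ne_of_mem_erase hk) _ _
        rw [update_self] at h2
        omega
      · intro j'
        by_cases h : j' = j
        · subst h; rw [hcur, update_self]; exact hb1
        · rw [hoth j i b j' h, update_of_ne h]; exact hA j'
      · intro j'
        by_cases h : j' = j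
        · subst h; rw [hcur]; exact hb2
        · rw [hoth j i b j' h]; exact ⟨z j', hz j', hzf j'⟩

lemma Adversary.nandComp {d : ℕ} (h : Adversary f (d + 1) fun _ => none) :
    Adversary (nandComp n f) (n * (d + 1)) fun _ => none :=
  Adversary.nandComp_of_budget _ (fun _ => d + 1) _ (by simp) (fun _ => h) fun _ => h.1 true

end Query

/-! ### Cheat sheet functions -/

section CheatSheet

variable {κ : Type} [DecidableEq κ]

lemma exists_listing (w : ℕ) : ∃ g : (Fin w → Option κ) → Finset κ,
    (∀ p, (g p).card ≤ w) ∧ ∀ T : Finset κ, T.card ≤ w → ∃ p, g p = T := by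
  refine ⟨fun p => (univ.image p).eraseNone, fun p => ?_, fun T hT => ?_⟩
  · refine (card_eraseNone_le _).trans (card_image_le.trans_eq (by simp))
  · refine ⟨fun j => if h : j.val < T.card then some (T.equivFin.symm ⟨j, h⟩) else none, ?_⟩
    ext k
    simp only [mem_eraseNone, mem_image, mem_univ, true_and]
    constructor
    · rintro ⟨j, hj⟩
      split_ifs at hj with h
      rw [← Option.some.inj hj]
      exact coe_mem _
    · intro hk
      have hlt := (T.equivFin ⟨k, hk⟩).isLt
      exact ⟨⟨T.equivFin ⟨k, hk⟩, hlt.trans_le hT⟩, by simp⟩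

lemma exists_decoder [Fintype κ] (w : ℕ) {L : ℕ} (h : Fintype.card κ + 1 ≤ 2 ^ L) :
    ∃ dec : (Fin w → Fin L → Bool) → Finset κ,
      (∀ q, (dec q).card ≤ w) ∧ ∀ T : Finset κ, T.card ≤ w → ∃ q, dec q = T := by
  obtain ⟨g, hg, hg'⟩ := exists_listing (κ := κ) w
  obtain ⟨e⟩ : Nonempty (Option κ ↪ (Fin L → Bool)) :=
    Function.Embedding.nonempty_of_card_le (by simpa using h)
  refine ⟨fun q => g fun j => invFun e (q j), fun q => hg _, fun T hT => ?_⟩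
  obtain ⟨p, hp⟩ := hg' T hT
  refine ⟨fun j => e (p j), ?_⟩
  simp only [leftInverse_invFun e.injective _, ← hp]

/-- The index type of a cheat sheet function: `c` blocks of inputs, and for every address in
`{0,1}^c` a cell holding `c` encoded certificates of size `w`. -/
abbrev SheetIdx (κ : Type) (c w L : ℕ) : Type :=
  (Fin c × κ) ⊕ ((Fin c → Bool) × Fin c × Fin w × Fin L)

/-- The set `T` of coordinates is a certificate for `h` at `x`. -/
def Certifies (h : (κ → Bool) → Bool) (x : κ → Bool) (T : Finset κ) : Prop :=
  ∀ x', (∀ k ∈ T, x' k = x k) → h x' = h x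

lemma Certifies.congr {h : (κ → Bool) → Bool} {x x' : κ → Bool} {T : Finset κ}
    (hh : h x' = h x) (hx : ∀ k ∈ T, x' k = x k) : Certifies h x' T ↔ Certifies h x T := by
  unfold Certifies
  rw [hh]
  refine forall_congr' fun y => imp_congr_left (forall₂_congr fun k hk => by rw [hx k hk])

variable {c w L : ℕ}

/-- The inputs of block `i`. -/
def block (z : SheetIdx κ c w L → Bool) (i : Fin c) (k : κ) : Bool := z (.inl (i, k))

/-- The contents of the cell at address `l`. -/
def cell (z : SheetIdx κ c w L → Bool) (l : Fin c → Bool) (i : Fin c) (a : Fin w) (b : Fin L) :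
    Bool := z (.inr (l, i, a, b))

/-- The address computed by the blocks. -/
def addr (h : (κ → Bool) → Bool) (z : SheetIdx κ c w L → Bool) (i : Fin c) : Bool := h (block z i)

/-- The set described by entry `i` of the cell pointed to by the blocks. -/
def claimed (h : (κ → Bool) → Bool) (dec : (Fin w → Fin L → Bool) → Finset κ)
    (z : SheetIdx κ c w L → Bool) (i : Fin c) : Finset κ := dec (cell z (addr h z) i)

open Classical in
/-- The cheat sheet function of `h`: the cell pointed to by the blocks must contain
certificates for all blocks. -/
noncomputable def sheet (h : (κ → Bool) → Bool) (dec : (Fin w → Fin L → Bool) → Finset κ)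
    (z : SheetIdx κ c w L → Bool) : Bool :=
  decide (∀ i, Certifies h (block z i) (claimed h dec z i))

/-- The coordinates in the sets `T i` of the blocks `i`. -/
def blockCoords (T : Fin c → Finset κ) : Finset (SheetIdx κ c w L) :=
  (univ.biUnion fun i => (T i).image (Prod.mk i)).image Sum.inl

/-- The coordinates of the cell at address `l`. -/
def cellCoords (l : Fin c → Bool) : Finset (SheetIdx κ c w L) :=
  univ.image fun p => .inr (l, p)

lemma mem_blockCoords {T : Fin c → Finset κ} {i : Fin c} {k : κ} (h : k ∈ T i) :
    (.inl (i, k) : SheetIdx κ c w L) ∈ blockCoords T :=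
  mem_image_of_mem _ (mem_copies.2 ⟨mem_univ i, h⟩)

lemma mem_cellCoords {l : Fin c → Bool} (p) :
    (.inr (l, p) : SheetIdx κ c w L) ∈ cellCoords l := mem_image_of_mem _ (mem_univ p)

lemma card_blockCoords_le {T : Fin c → Finset κ} {u : ℕ} (h : ∀ i, (T i).card ≤ u) :
    (blockCoords T : Finset (SheetIdx κ c w L)).card ≤ c * u := by
  refine card_image_le.trans ?_
  simpa using card_biUnion_copies_le univ T u fun i _ => h i

lemma card_cellCoords_le {l : Fin c → Bool} :
    (cellCoords l : Finset (SheetIdx κ c w L)).card ≤ c * w * L := by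
  refine card_image_le.trans ?_
  simp [mul_assoc]

/-- The coordinates inspected when verifying the cell pointed to by the blocks. -/
def checked (h : (κ → Bool) → Bool) (dec : (Fin w → Fin L → Bool) → Finset κ)
    (z : SheetIdx κ c w L → Bool) : Finset (SheetIdx κ c w L) :=
  cellCoords (addr h z) ∪ blockCoords (claimed h dec z)

variable {h : (κ → Bool) → Bool} {dec : (Fin w → Fin L → Bool) → Finset κ}

lemma card_checked_le (hdec : ∀ q, (dec q).card ≤ w) (z : SheetIdx κ c w L → Bool) :
    (checked h dec z).card ≤ c * w * L + c * w :=
  (card_union_le _ _).trans (add_le_add card_cellCoords_le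
    (card_blockCoords_le fun _ => hdec _))

lemma sheet_congr {z z' : SheetIdx κ c w L → Bool} (ha : addr h z' = addr h z)
    (hz : ∀ i ∈ checked h dec z, z' i = z i) :
    checked h dec z' = checked h dec z ∧ sheet h dec z' = sheet h dec z := by
  have hc : claimed h dec z' = claimed h dec z := by
    funext i
    unfold claimed
    rw [ha]
    congr 1
    funext a b
    exact hz _ (mem_union_left _ (mem_cellCoords _))
  refine ⟨by unfold checked; rw [ha, hc], ?_⟩
  rw [Bool.eq_iff_iff]
  simp only [sheet, hc, decide_eq_true_eq]
  refine forall_congr' fun i => Certifies.congr (congrFun ha i) fun k hk => ?_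
  exact hz _ (mem_union_right _ (mem_blockCoords hk))

lemma addr_eq_of_sheet {z z' : SheetIdx κ c w L → Bool} (hs : sheet h dec z = true)
    (hz : ∀ i ∈ checked h dec z, z' i = z i) : addr h z' = addr h z := by
  simp only [sheet, decide_eq_true_eq] at hs
  funext i
  exact hs i _ fun k hk => hz _ (mem_union_right _ (mem_blockCoords hk))

lemma HasUnambiguousCert.cheatSheet {u : ℕ} (hdec : ∀ q, (dec q).card ≤ w)
    (hu : HasUnambiguousCert h u u) :
    HasUnambiguousCert (sheet (c := c) h dec) (c * w * L + c * w)
      (c * w * L + c * w + c * u) := by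
  obtain ⟨S, hS, hc⟩ := hu
  simp only [ite_self] at hc
  refine ⟨fun z => if sheet h dec z = true then checked h dec z else
    checked h dec z ∪ blockCoords fun i => S (block z i), fun z z' hz => ?_, fun z => ?_⟩
  · by_cases hs : sheet h dec z = true
    · simp only [hs, if_true] at hz ⊢
      obtain ⟨h1, h2⟩ := sheet_congr (addr_eq_of_sheet hs hz) hz
      simp [h1, h2, hs]
    · simp only [hs, Bool.false_eq_true, if_false] at hz ⊢
      have hb := fun i => hS (block z i) (block z' i) fun k hk =>
        hz _ (mem_union_right _ (mem_blockCoords (T := fun i => S (block z i)) hk))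
      obtain ⟨h1, h2⟩ := sheet_congr (dec := dec) (funext fun i => (hb i).2)
        fun i hi => hz i (mem_union_left _ hi)
      simp [h1, h2, hs, (hb _).1]
  · dsimp only
    split_ifs
    · exact card_checked_le hdec z
    · exact (card_union_le _ _).trans (add_le_add (card_checked_le hdec z)
        (card_blockCoords_le fun _ => hc _))

lemma HasCert.sheet_false (hdec : ∀ q, (dec q).card ≤ w) (hw : ∀ b, HasCert h b w) :
    HasCert (sheet (c := c) h dec) false (c * w * L + c * w + c * w) := by
  intro z hz
  choose T hT hT' using fun i => hw _ (block z i) rfl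
  refine ⟨checked h dec z ∪ blockCoords T, (card_union_le _ _).trans (add_le_add
    (card_checked_le hdec z) (card_blockCoords_le hT)), fun z' hz' => ?_⟩
  rw [← hz]
  refine (sheet_congr (funext fun i => ?_) fun i hi => hz' i (mem_union_left _ hi)).2
  exact hT' i _ fun k hk => hz' _ (mem_union_right _ (mem_blockCoords hk))

lemma Adversary.cheatSheet_of_budget (hdec : ∀ T : Finset κ, T.card ≤ w → ∃ q, dec q = T)
    (hw : ∀ b, HasCert h b w) (hc : 0 < c) (r : ℕ) :
    ∀ (ρ : SheetIdx κ c w L → Option Bool) (t : Finset (Fin c → Bool)), t.card + r ≤ 2 ^ c →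
      (∀ i, Adversary h r fun k => ρ (.inl (i, k))) →
      (∀ l p, l ∉ t → ρ (.inr (l, p)) = none) → Adversary (sheet h dec) r ρ := by
  induction r with
  | zero => intros; trivial
  | succ r ih =>
    intro ρ t ht hA hρ
    refine ⟨fun b => ?_, ?_⟩
    · obtain ⟨l, hl⟩ : ∃ l, l ∉ t := by
        by_contra! hcon
        have : t = univ := eq_univ_iff_forall.2 hcon
        simp [this] at ht
      choose x hx hxl using fun i => (hA i).1 (l i)
      obtain ⟨T, hT, hTb⟩ : ∃ T : Fin c → Finset κ, (∀ i, (T i).card ≤ w) ∧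
          ((∀ i, Certifies h (x i) (T i)) ↔ b = true) := by
        cases b
        · refine ⟨fun _ => ∅, by simp, iff_of_false (fun hcon => ?_) (by simp)⟩
          obtain ⟨y, -, hy⟩ := (hA ⟨0, hc⟩).1 (!h (x ⟨0, hc⟩))
          have := hcon ⟨0, hc⟩ y (by simp)
          rw [hy] at this
          simp at this
        · choose T hT hT' using fun i => hw _ (x i) rfl
          exact ⟨T, hT, iff_of_true hT' rfl⟩
      choose q hq using fun i => hdec _ (hT i)
      let z : SheetIdx κ c w L → Bool := Sum.elim (fun p => x p.1 p.2)
        fun p => if p.1 = l then q p.2.1 p.2.2.1 p.2.2.2 else (ρ (.inr p)).getD false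
      have hbl : ∀ i, block z i = x i := fun i => rfl
      have had : addr h z = l := funext fun i => by simp [addr, hbl, hxl]
      have hcl : claimed h dec z = T := funext fun i => by
        unfold claimed
        rw [had, ← hq]
        congr 1
        funext a b
        simp [cell, z]
      refine ⟨z, ?_, ?_⟩
      · rintro (⟨i, k⟩ | ⟨l', p⟩) b' hb'
        · exact hx i k b' hb'
        · have : l' ≠ l := by
            rintro rfl
            rw [hρ _ _ hl] at hb'
            cases hb'
          simp [z, this, hb']
      · rw [Bool.eq_iff_iff, ← hTb]
        simp [sheet, hcl, hbl]
    · rintro (⟨i, k⟩ | ⟨l, p⟩) hn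
      · obtain ⟨b, hb⟩ := (hA i).2 k hn
        refine ⟨b, ih _ t (by omega) (fun i' => ?_) fun l p hl => ?_⟩
        · by_cases hi : i' = i
          · subst hi
            convert hb using 1
            funext k'
            by_cases hk : k' = k
            · subst hk; simp
            · rw [update_of_ne hk, update_of_ne (by simpa using hk)]
          · convert (hA i').mono (Nat.le_succ r) using 1
            funext k'
            rw [update_of_ne (by simp [hi])]
        · rw [update_of_ne (by simp)]
          exact hρ l p hl
      · refine ⟨false, ih _ (insert l t) ?_ (fun i' => ?_) fun l' p' hl' => ?_⟩
        · have := card_insert_le l t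
          omega
        · convert (hA i').mono (Nat.le_succ r) using 1
          funext k
          rw [update_of_ne (by simp)]
        · rw [mem_insert, not_or] at hl'
          rw [update_of_ne (by simp [hl'.1])]
          exact hρ _ _ hl'.2

lemma Adversary.cheatSheet {r : ℕ} (hdec : ∀ T : Finset κ, T.card ≤ w → ∃ q, dec q = T)
    (hw : ∀ b, HasCert h b w) (hc : 0 < c) (hr : r ≤ 2 ^ c) (hA : Adversary h r fun _ => none) :
    Adversary (sheet (c := c) h dec) r fun _ => none :=
  Adversary.cheatSheet_of_budget hdec hw hc r _ ∅ (by simpa using hr) (fun _ => hA) (by simp)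

end CheatSheet

/-! ### Partitions into rectangles -/

section Partition

variable {X Y : Type} {F : X → Y → Bool}

lemma exists_partition_of_key {α : Type} (key : X × Y → α) (K : Finset α) (hK : ∀ p, key p ∈ K)
    (hR : ∀ p, IsMonoRect F {q | key q = key p}) :
    ∃ R : Fin K.card → Set (X × Y), (∀ i, IsMonoRect F (R i)) ∧ ∀ z : X × Y, ∃! i, z ∈ R i := by
  refine ⟨fun i => {q | key q = K.equivFin.symm i}, fun i => ?_, fun z => ?_⟩
  · by_cases h : ∃ p, key p = K.equivFin.symm i
    · obtain ⟨p, hp⟩ := h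
      dsimp only
      rw [← hp]
      exact hR p
    · push Not at h
      have : {q | key q = K.equivFin.symm i} = ∅ := Set.eq_empty_iff_forall_notMem.2 h
      dsimp only
      rw [this]
      exact ⟨⟨∅, ∅, by simp⟩, false, by simp⟩
  · refine ⟨K.equivFin ⟨key z, hK z⟩, by simp, fun i hi => ?_⟩
    rw [← Equiv.symm_apply_eq]
    exact Subtype.ext (Eq.symm hi)

lemma partitionNumber_le_of_key {α : Type} (key : X × Y → α) (K : Finset α)
    (hK : ∀ p, key p ∈ K) (hR : ∀ p, IsMonoRect F {q | key q = key p}) :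
    partitionNumber F ≤ K.card := Nat.sInf_le (exists_partition_of_key key K hK hR)

lemma exists_partition [Fintype X] [Fintype Y] (F : X → Y → Bool) :
    ∃ R : Fin (partitionNumber F) → Set (X × Y), (∀ i, IsMonoRect F (R i)) ∧
      ∀ z : X × Y, ∃! i, z ∈ R i := by
  refine Nat.sInf_mem (s := {t : ℕ | ∃ R : Fin t → Set (X × Y), (∀ i, IsMonoRect F (R i)) ∧
    ∀ z : X × Y, ∃! i, z ∈ R i}) ⟨_, exists_partition_of_key id univ (by simp) fun p => ?_⟩
  refine ⟨⟨{p.1}, {p.2}, ?_⟩, F p.1 p.2, ?_⟩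
  · ext ⟨a, b⟩
    simp [Prod.ext_iff]
  · rintro z rfl
    rfl

open Classical in
/-- The protocol asking, for the rectangles in a list one by one, whether the input is contained in
them. -/
noncomputable def searchProtocol {κ : Type} (A : κ → Set X) (B : κ → Set Y) (b : κ → Bool) :
    List κ → Protocol X Y
  | [] => .leaf false
  | i :: l => .nodeA (fun x => decide (x ∈ A i)) (searchProtocol A B b l)
      (.nodeB (fun y => decide (y ∈ B i)) (searchProtocol A B b l) (.leaf (b i)))

lemma depth_searchProtocol {κ : Type} (A : κ → Set X) (B : κ → Set Y) (b : κ → Bool)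
    (l : List κ) : (searchProtocol A B b l).depth ≤ 2 * l.length := by
  induction l with
  | nil => simp [searchProtocol, Protocol.depth]
  | cons i l ih =>
    simp only [searchProtocol, Protocol.depth, List.length_cons]
    omega

lemma eval_searchProtocol {κ : Type} {A : κ → Set X} {B : κ → Set Y} {b : κ → Bool}
    (h : ∀ i, ∀ x ∈ A i, ∀ y ∈ B i, F x y = b i) {x : X} {y : Y} {l : List κ}
    (hl : ∃ i ∈ l, x ∈ A i ∧ y ∈ B i) : (searchProtocol A B b l).eval x y = F x y := by
  induction l with
  | nil => simp at hl
  | cons i l ih =>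
    by_cases hi : x ∈ A i ∧ y ∈ B i
    · simp [searchProtocol, Protocol.eval, hi.1, hi.2, h i x hi.1 y hi.2]
    · have ih := ih (by
        obtain ⟨j, hj, hj'⟩ := hl
        rcases List.mem_cons.1 hj with rfl | hj
        · exact absurd hj' hi
        · exact ⟨j, hj, hj'⟩)
      by_cases hx : x ∈ A i
      · have hy : y ∉ B i := fun hy => hi ⟨hx, hy⟩
        simp [searchProtocol, Protocol.eval, hx, hy, ih]
      · simp [searchProtocol, Protocol.eval, hx, ih]

lemma exists_protocol [Fintype X] [Fintype Y] (F : X → Y → Bool) :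
    ∃ P : Protocol X Y, P.depth ≤ 2 * partitionNumber F ∧ ∀ x y, P.eval x y = F x y := by
  obtain ⟨R, hR, hu⟩ := exists_partition F
  choose A B hAB using fun i => (hR i).1
  choose b hb using fun i => (hR i).2
  refine ⟨searchProtocol A B b (List.finRange _), (depth_searchProtocol _ _ _ _).trans_eq (by simp),
    fun x y => eval_searchProtocol (fun i x hx y hy => hb i (x, y) ?_) ?_⟩
  · rw [hAB]; exact ⟨hx, hy⟩
  · obtain ⟨i, hi, -⟩ := hu (x, y)
    rw [hAB] at hi
    exact ⟨i, List.mem_finRange i, hi⟩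

lemma le_dcc [Fintype X] [Fintype Y] {d : ℕ}
    (h : ∀ P : Protocol X Y, (∀ x y, P.eval x y = F x y) → d ≤ P.depth) : d ≤ Dcc F := by
  obtain ⟨P, hP, hPF⟩ := exists_protocol F
  obtain ⟨Q, hQ, hQF⟩ := Nat.sInf_mem
    (s := {d : ℕ | ∃ P : Protocol X Y, P.depth ≤ d ∧ ∀ x y, P.eval x y = F x y}) ⟨_, P, hP, hPF⟩
  exact (h Q hQF).trans hQ

lemma le_two_mul_partitionNumber [Fintype X] [Fintype Y] {d : ℕ}
    (h : ∀ P : Protocol X Y, (∀ x y, P.eval x y = F x y) → d ≤ P.depth) :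
    d ≤ 2 * partitionNumber F := by
  obtain ⟨P, hP, hPF⟩ := exists_protocol F
  exact (h P hPF).trans hP

/-- Unambiguous certificates for `f` give a partition for `f` composed with the index gadget. -/
lemma partitionNumber_indexed_le {ι : Type} [Fintype ι] [DecidableEq ι] {m v u : ℕ}
    {f : (ι → Bool) → Bool} (hf : HasUnambiguousCert f v u) (hvu : v ≤ u) :
    partitionNumber (indexed (m := m) f) ≤ (Fintype.card ι * (m * 2) + 1) ^ u := by
  obtain ⟨S, hS, hc⟩ := hf
  obtain ⟨g, -, hg⟩ := exists_listing (κ := ι × Fin m × Bool) u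
  let val : (ι → Fin m) × (ι → Fin m → Bool) → ι → Bool := fun p i => p.2 i (p.1 i)
  let key : (ι → Fin m) × (ι → Fin m → Bool) → Finset (ι × Fin m × Bool) := fun p =>
    (S (val p)).image fun i => (i, p.1 i, val p i)
  have hcard : (univ.image g).card ≤ (Fintype.card ι * (m * 2) + 1) ^ u :=
    card_image_le.trans_eq (by simp)
  refine (partitionNumber_le_of_key key (univ.image g) (fun p => ?_) fun p => ?_).trans hcard
  · obtain ⟨q, hq⟩ := hg (key p) (card_image_le.trans ((hc _).trans (by split_ifs <;> omega)))
    exact mem_image.2 ⟨q, mem_univ q, hq⟩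
  · have hval : ∀ q, key q = key p ↔ (∀ i ∈ S (val p), q.1 i = p.1 i) ∧
        ∀ i ∈ S (val p), q.2 i (p.1 i) = val p i := by
      intro q
      constructor
      · intro h
        have hq : ∀ i ∈ S (val p), q.1 i = p.1 i ∧ val q i = val p i := by
          intro i hi
          have : (i, p.1 i, val p i) ∈ key q := h ▸ mem_image_of_mem _ hi
          obtain ⟨j, -, hj⟩ := mem_image.1 this
          simp only [Prod.mk.injEq] at hj
          obtain ⟨rfl, h1, h2⟩ := hj
          exact ⟨h1, h2⟩
        exact ⟨fun i hi => (hq i hi).1, fun i hi => (hq i hi).1 ▸ (hq i hi).2⟩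
      · rintro ⟨h1, h2⟩
        have h3 : ∀ i ∈ S (val p), val q i = val p i := fun i hi => by
          rw [← h2 i hi, ← h1 i hi]
        dsimp only [key]
        rw [(hS _ _ h3).1]
        exact image_congr fun i hi => by simp only [h1 i hi, h3 i hi]
    refine ⟨⟨{x | ∀ i ∈ S (val p), x i = p.1 i}, {y | ∀ i ∈ S (val p), y i (p.1 i) = val p i}, ?_⟩,
      f (val p), fun q hq => ?_⟩
    · ext q
      exact hval q
    · obtain ⟨h1, h2⟩ := (hval q).1 hq
      exact (hS (val p) (val q) fun i hi => by rw [← h2 i hi, ← h1 i hi]).2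

end Partition

/-! ### Iterating the construction -/

section Iteration

lemma HasUnambiguousCert.mono {ι : Type} {f : (ι → Bool) → Bool} {v u v' u' : ℕ}
    (h : HasUnambiguousCert f v u) (hv : v ≤ v') (hu : u ≤ u') : HasUnambiguousCert f v' u' := by
  obtain ⟨S, hS, hc⟩ := h
  refine ⟨S, hS, fun z => (hc z).trans ?_⟩
  split_ifs <;> assumption

lemma adversary_nandComp_of_pos {ι : Type} [DecidableEq ι] {n d : ℕ} {f : (ι → Bool) → Bool}
    (hd : 0 < d) (h : Adversary f d fun _ => none) :
    Adversary (nandComp n f) (n * d) fun _ => none := by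
  obtain ⟨d, rfl⟩ := Nat.exists_eq_succ_of_ne_zero hd.ne'
  exact h.nandComp

/-- One round: two levels of `nandComp` followed by the cheat sheet construction. -/
lemma exists_round {ι : Type} [Fintype ι] [DecidableEq ι] {f : (ι → Bool) → Bool} {n d v c L : ℕ}
    (hn : 0 < n) (hd : 0 < d) (hA : Adversary f d fun _ => none)
    (hU : HasUnambiguousCert f v (n * v)) (hC : HasCert f false v)
    (hc : 0 < c) (hdc : n * (n * d) ≤ 2 ^ c) (hL : n * (n * Fintype.card ι) + 1 ≤ 2 ^ L) :
    ∃ (κ : Type) (_ : Fintype κ) (_ : DecidableEq κ) (g : (κ → Bool) → Bool),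
      Fintype.card κ = c * (n * (n * Fintype.card ι)) + 2 ^ c * (c * (n * v * L)) ∧
      Adversary g (n * (n * d)) (fun _ => none) ∧
      HasUnambiguousCert g (c * (n * v) * (L + 3)) (n * (c * (n * v) * (L + 3))) ∧
      HasCert g false (c * (n * v) * (L + 3)) := by
  have hC1 : HasCert (nandComp n f) true v := hC.nandComp_true
  have hC0 : HasCert (nandComp n f) false (n * v) := hU.hasCert_true.nandComp_false
  have hw : ∀ b, HasCert (nandComp n (nandComp n f)) b (n * v)
    | true => hC0.nandComp_true
    | false => hC1.nandComp_false
  have hU' : HasUnambiguousCert (nandComp n (nandComp n f)) (n * (n * v + n * v))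
      (n * (n * v + n * v)) := hU.nandComp_scan.nandComp_all
  obtain ⟨dec, hdec, hdec'⟩ := exists_decoder (κ := Fin n × Fin n × ι) (n * v) (L := L)
    (by simpa using hL)
  refine ⟨SheetIdx (Fin n × Fin n × ι) c (n * v) L, inferInstance, inferInstance,
    sheet (nandComp n (nandComp n f)) dec, by simp, ?_, ?_, ?_⟩
  · exact Adversary.cheatSheet hdec' hw hc hdc
      (adversary_nandComp_of_pos (Nat.mul_pos hn hd) (adversary_nandComp_of_pos hd hA))
  · refine (hU'.cheatSheet hdec).mono (by ring_nf; omega) ?_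
    have h1 : c * (n * v) * (L + 1) ≤ n * (c * (n * v) * (L + 1)) := Nat.le_mul_of_pos_left _ hn
    calc _ = c * (n * v) * (L + 1) + 2 * (n * (c * (n * v))) := by ring
      _ ≤ n * (c * (n * v) * (L + 1)) + 2 * (n * (c * (n * v))) := by omega
      _ = _ := by ring
  · exact (HasCert.sheet_false hdec hw).mono (by ring_nf; omega)

lemma le_two_pow_mul (b : ℕ) {a : ℕ} (ha : 0 < a) : b ≤ 2 ^ (b * a) :=
  Nat.lt_two_pow_self.le.trans (Nat.pow_le_pow_right two_pos (Nat.le_mul_of_pos_right _ ha))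

lemma exists_query_function (k : ℕ) : ∃ E : ℕ, ∀ a : ℕ, 0 < a →
    ∃ (ι : Type) (_ : Fintype ι) (_ : DecidableEq ι) (f : (ι → Bool) → Bool) (v : ℕ),
      Fintype.card ι ≤ 2 ^ (E * a) ∧ Adversary f (2 ^ (2 * k * a)) (fun _ => none) ∧
      HasUnambiguousCert f v (2 ^ a * v) ∧ HasCert f false v ∧
      v ≤ E * a ^ E * 2 ^ (k * a) := by
  induction k with
  | zero =>
    refine ⟨1, fun a ha => ⟨Unit, inferInstance, inferInstance, fun z => z (), 1, ?_, ?_, ?_, ?_, ?_⟩⟩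
    · simpa using Nat.one_le_two_pow
    · simp only [mul_zero, zero_mul, pow_zero]
      exact ⟨fun b => ⟨fun _ => b, ⟨fun i b h => (nomatch h), rfl⟩⟩, fun _ _ => ⟨true, trivial⟩⟩
    · refine ⟨fun _ => univ, fun z z' h => ⟨rfl, h () (mem_univ _)⟩, fun z => ?_⟩
      have : 1 ≤ 2 ^ a := Nat.one_le_two_pow
      split_ifs <;> simp [this]
    · exact fun z hz => ⟨univ, by simp, fun z' h => (h () (mem_univ _)).trans hz⟩
    · simpa using Nat.succ_le_of_lt ha
  | succ k ih =>
    obtain ⟨E, hE⟩ := ih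
    refine ⟨2 * (k + 1) * E * (E + 6) + 8 * E + 8 * k + 20, fun a ha => ?_⟩
    obtain ⟨ι, _, _, f, v, hN, hA, hU, hC, hv⟩ := hE a ha
    have hd : 2 ^ a * (2 ^ a * 2 ^ (2 * k * a)) = 2 ^ (2 * (k + 1) * a) := by
      rw [← pow_add, ← pow_add]
      ring_nf
    have hcard : 2 ^ a * (2 ^ a * Fintype.card ι) ≤ 2 ^ ((E + 2) * a) := by
      calc _ ≤ 2 ^ a * (2 ^ a * 2 ^ (E * a)) := by gcongr
        _ = _ := by rw [← pow_add, ← pow_add]; ring_nf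
    have hL : 2 ^ a * (2 ^ a * Fintype.card ι) + 1 ≤ 2 ^ ((E + 2) * a + 1) := by
      have : 1 ≤ 2 ^ ((E + 2) * a) := Nat.one_le_two_pow
      rw [pow_succ]
      omega
    obtain ⟨κ, _, _, g, hκ, hA', hU', hC'⟩ := exists_round (c := 2 * (k + 1) * a) (by positivity)
      (by positivity) hA hU hC (by positivity) hd.le hL
    rw [hd] at hA'
    refine ⟨κ, inferInstance, inferInstance, g, _, ?_, hA', hU', hC', ?_⟩
    · have hc : 2 * (k + 1) * a ≤ 2 ^ (2 * (k + 1) * a) := Nat.lt_two_pow_self.le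
      have hva : 2 ^ a * v ≤ 2 ^ ((1 + 2 * E + k) * a) := by
        calc _ ≤ 2 ^ a * (2 ^ (E * a) * (2 ^ a) ^ E * 2 ^ (k * a)) := by
              gcongr
              refine hv.trans ?_
              gcongr
              · exact le_two_pow_mul E ha
              · exact Nat.lt_two_pow_self.le
          _ = _ := by rw [← pow_mul, ← pow_add, ← pow_add, ← pow_add]; ring_nf
      have hL' : (E + 2) * a + 1 ≤ 2 ^ ((E + 3) * a) := by
        calc _ ≤ (E + 3) * a := by nlinarith
          _ ≤ _ := Nat.lt_two_pow_self.le
      rw [hκ]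
      calc _ ≤ 2 ^ (2 * (k + 1) * a) * 2 ^ ((E + 2) * a) + 2 ^ (2 * (k + 1) * a) *
            (2 ^ (2 * (k + 1) * a) * (2 ^ ((1 + 2 * E + k) * a) * 2 ^ ((E + 3) * a))) := by gcongr
        _ = 2 ^ ((2 * k + E + 4) * a) + 2 ^ ((5 * k + 3 * E + 8) * a) := by
            simp only [← pow_add]
            ring_nf
        _ ≤ 2 ^ ((5 * k + 3 * E + 8) * a) + 2 ^ ((5 * k + 3 * E + 8) * a) := by
            gcongr <;> omega
        _ = 2 ^ ((5 * k + 3 * E + 8) * a + 1) := by rw [pow_succ]; ring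
        _ ≤ 2 ^ ((5 * k + 3 * E + 8 + 1) * a) := by
            refine Nat.pow_le_pow_right two_pos ?_
            nlinarith
        _ ≤ _ := by
            refine Nat.pow_le_pow_right two_pos (Nat.mul_le_mul_right _ ?_)
            omega
    · have hL' : (E + 2) * a + 1 + 3 ≤ (E + 6) * a := by nlinarith
      calc _ ≤ 2 * (k + 1) * a * (2 ^ a * (E * a ^ E * 2 ^ (k * a))) * ((E + 6) * a) := by gcongr
        _ = (2 * (k + 1) * E * (E + 6)) * a ^ (E + 2) * 2 ^ ((k + 1) * a) := by
            rw [add_mul k 1 a, pow_add 2 (k * a), one_mul, pow_add a E 2]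
            ring
        _ ≤ _ := by gcongr <;> omega

lemma add_mul_pow_le (q n : ℕ) : (q + n) * q ^ n ≤ q * (q + 1) ^ n := by
  induction n with
  | zero => simp
  | succ n ih =>
    calc _ = (q + (n + 1)) * q * q ^ n := by ring
      _ ≤ (q + n) * (q + 1) * q ^ n := Nat.mul_le_mul_right _ (by nlinarith)
      _ = (q + n) * q ^ n * (q + 1) := by ring
      _ ≤ q * (q + 1) ^ n * (q + 1) := by gcongr
      _ = _ := by ring

lemma exists_gadgetParams {N d p : ℕ} (hN : N ≤ 2 ^ p) (hd : d ≤ 2 ^ p) :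
    ∃ m τ s ℓ, m ≤ 2 ^ (8 * p + 40) ∧ GadgetParams N m τ s ℓ (d + 2 * N) := by
  set t := 2 ^ (p + 4) with ht
  set τ := 2 ^ (7 * p + 36) with hτ
  set r := (8 * p + 40) * 2 ^ p + 2 with hr
  have hm : 2 ^ (8 * p + 40) = τ * t := by rw [ht, hτ, ← pow_add]; ring_nf
  have ht0 : 0 < t := by positivity
  refine ⟨2 ^ (8 * p + 40), τ, t * r, 8 * p + 41, le_rfl, by positivity, ?_, ?_, ?_, ?_⟩
  · rw [pow_succ _ (8 * p + 40), mul_comm]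
  · calc 16 * (τ * N) ≤ 16 * (τ * 2 ^ p) := by gcongr
      _ = τ * t := by rw [ht, pow_add]; ring
      _ = _ := hm.symm
  · have h1 : 2 * (t - 1) ^ t ≤ t ^ t := by
      obtain ⟨q, hq⟩ : ∃ q, t = q + 1 := ⟨t - 1, by omega⟩
      rw [hq, Nat.add_sub_cancel]
      rcases Nat.eq_zero_or_pos q with rfl | hq0
      · simp
      · refine Nat.le_of_mul_le_mul_left ?_ hq0
        calc _ = (q + q) * q ^ (q + 1) := by ring
          _ ≤ (q + (q + 1)) * q ^ (q + 1) := by gcongr; omega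
          _ ≤ _ := add_mul_pow_le q (q + 1)
    have h2 : 2 * (2 ^ (8 * p + 40) - τ) ^ t ≤ (2 ^ (8 * p + 40)) ^ t := by
      have : τ * t - τ = τ * (t - 1) := by rw [Nat.mul_sub, mul_one]
      rw [hm, this, mul_pow, mul_pow, ← mul_assoc, mul_comm 2, mul_assoc]
      gcongr
    have h3 : 4 * (2 ^ (8 * p + 40)) ^ N ≤ 2 ^ r := by
      rw [hr, pow_add 2 (_ * 2 ^ p) 2, ← pow_mul, mul_comm _ (2 ^ 2)]
      gcongr <;> norm_num
    calc _ = 4 * (2 ^ (8 * p + 40)) ^ N * ((2 ^ (8 * p + 40) - τ) ^ t) ^ r := by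
          rw [pow_mul, mul_assoc]
      _ ≤ 2 ^ r * ((2 ^ (8 * p + 40) - τ) ^ t) ^ r := by gcongr
      _ = (2 * (2 ^ (8 * p + 40) - τ) ^ t) ^ r := by rw [mul_pow]
      _ ≤ ((2 ^ (8 * p + 40)) ^ t) ^ r := by gcongr
      _ = _ := by rw [pow_mul]
  · have hp : p + 1 ≤ 2 ^ p := Nat.lt_two_pow_self
    have hs : t * r ≤ 2 ^ (3 * p + 10) := by
      have : r ≤ 2 ^ (2 * p + 6) := by
        calc r ≤ 2 ^ 6 * 2 ^ p * 2 ^ p := by rw [hr]; nlinarith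
          _ = _ := by rw [← pow_add, ← pow_add]; ring_nf
      calc t * r ≤ 2 ^ (p + 4) * 2 ^ (2 * p + 6) := by gcongr
        _ = _ := by rw [← pow_add]; ring_nf
    have hl : 8 * p + 41 + 1 ≤ 2 ^ (p + 6) := by
      rw [pow_add]; omega
    have hC : d + 2 * N + 2 ≤ 2 ^ (3 * p + 10) := by
      have : 2 ^ p ≤ 2 ^ (3 * p) := Nat.pow_le_pow_right two_pos (by omega)
      rw [pow_add]; omega
    calc 4 * (t * r * (d + 2 * N + 2 + t * r * (8 * p + 41)))
        ≤ 4 * (2 ^ (3 * p + 10) * (2 ^ (3 * p + 10) + 2 ^ (3 * p + 10) * (8 * p + 41))) := by gcongr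
      _ = 2 ^ 2 * (2 ^ (3 * p + 10) * (2 ^ (3 * p + 10) * (8 * p + 41 + 1))) := by ring
      _ ≤ 2 ^ 2 * (2 ^ (3 * p + 10) * (2 ^ (3 * p + 10) * 2 ^ (p + 6))) := by gcongr
      _ = 2 ^ (7 * p + 28) := by rw [← pow_add, ← pow_add, ← pow_add]; ring_nf
      _ ≤ _ := Nat.pow_le_pow_right two_pos (by omega)

lemma exists_communication_function (k : ℕ) : ∃ E : ℕ, ∀ a : ℕ, 0 < a →
    ∃ (X Y : Type) (_ : Fintype X) (_ : Fintype Y) (F : X → Y → Bool),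
      2 ^ (2 * k * a) ≤ Dcc F ∧ 2 ^ (2 * k * a) ≤ 2 * partitionNumber F ∧
      partitionNumber F ≤ 2 ^ (E * a ^ E * 2 ^ ((k + 1) * a)) := by
  obtain ⟨E, hE⟩ := exists_query_function k
  refine ⟨(9 * E + 18 * k + 42) * E + E + 1, fun a ha => ?_⟩
  obtain ⟨ι, _, _, f, v, hN, hA, hU, hC, hv⟩ := hE a ha
  have hN' : Fintype.card ι ≤ 2 ^ ((E + 2 * k) * a) :=
    hN.trans (Nat.pow_le_pow_right two_pos (Nat.mul_le_mul_right _ (by omega)))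
  obtain ⟨m, τ, s, ℓ, hm, hp⟩ := exists_gadgetParams hN' (d := 2 ^ (2 * k * a))
    (Nat.pow_le_pow_right two_pos (Nat.mul_le_mul_right _ (by omega)))
  have hdepth := le_depth_of_adversary _ hp hA
  refine ⟨_, _, inferInstance, inferInstance, indexed f, le_dcc hdepth,
    le_two_mul_partitionNumber hdepth, ?_⟩
  refine (partitionNumber_indexed_le hU (Nat.le_mul_of_pos_left _ (by positivity))).trans ?_
  set p := (E + 2 * k) * a with hpa
  have hbase : Fintype.card ι * (m * 2) + 1 ≤ 2 ^ (9 * p + 42) := by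
    calc _ ≤ 2 ^ p * (2 ^ (8 * p + 40) * 2) + 1 := by gcongr
      _ = 2 ^ (9 * p + 41) + 1 := by ring_nf
      _ ≤ 2 ^ (9 * p + 41) + 2 ^ (9 * p + 41) := by gcongr; exact Nat.one_le_two_pow
      _ = _ := by ring_nf
  calc _ ≤ (2 ^ (9 * p + 42)) ^ (2 ^ a * v) := by gcongr
    _ = 2 ^ ((9 * p + 42) * (2 ^ a * v)) := by rw [← pow_mul]
    _ ≤ _ := by
      refine Nat.pow_le_pow_right two_pos ?_
      have h1 : 9 * p + 42 ≤ (9 * E + 18 * k + 42) * a := by rw [hpa]; nlinarith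
      calc _ ≤ (9 * E + 18 * k + 42) * a * (2 ^ a * (E * a ^ E * 2 ^ (k * a))) := by gcongr
        _ = (9 * E + 18 * k + 42) * E * a ^ (E + 1) * 2 ^ ((k + 1) * a) := by
            rw [add_mul k 1 a, pow_add 2 (k * a), one_mul, pow_succ]
            ring
        _ ≤ _ := by gcongr <;> omega

end Iteration

/-! ### Asymptotics -/

section Asymptotics

open Filter Topology

lemma eventually_mul_pow_le_two_pow (E j : ℕ) : ∀ᶠ a : ℕ in atTop, E * a ^ j ≤ 2 ^ a := by
  have h := (tendsto_pow_const_div_const_pow_of_one_lt j (one_lt_two (α := ℝ))).const_mul (E : ℝ)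
  rw [mul_zero] at h
  filter_upwards [h.eventually_le_const one_pos] with a ha
  rw [← mul_div_assoc, div_le_one (by positivity)] at ha
  exact_mod_cast ha

lemma rpow_two_sub_le {ε x : ℝ} {k a E : ℕ} (hε : 0 < ε) (hk : 3 ≤ ε * (k + 1)) (hk' : 2 ≤ k)
    (hE : E ^ 2 * a ^ (2 * E) ≤ 2 ^ a) (hx : 1 ≤ x)
    (hx' : x ≤ ((E * a ^ E * 2 ^ ((k + 1) * a) : ℕ) : ℝ)) :
    x ^ (2 - ε) ≤ 2 ^ (2 * k * a) := by
  set δ := min ε 1 with hδ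
  have hδ0 : 0 < δ := lt_min hε one_pos
  have hδ1 : δ ≤ 1 := min_le_right _ _
  have hδk : 3 ≤ δ * (k + 1) := by
    rcases min_choice ε 1 with h | h
    · rw [hδ, h]; exact hk
    · rw [hδ, h]
      have : (2 : ℝ) ≤ k := by exact_mod_cast hk'
      linarith
  push_cast at hx'
  have h1 : (1 : ℝ) ≤ E * a ^ E := by
    have h0 : E * a ^ E ≠ 0 := by
      intro h0
      have : (E : ℝ) * a ^ E = 0 := by exact_mod_cast h0
      rw [this, zero_mul] at hx'
      linarith
    exact_mod_cast Nat.one_le_iff_ne_zero.2 h0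
  have hE' : ((E : ℝ) * a ^ E) ^ 2 ≤ 2 ^ a := by
    have : (E * a ^ E) ^ 2 ≤ 2 ^ a := by
      rw [mul_pow, ← pow_mul, mul_comm E 2]
      exact hE
    exact_mod_cast this
  calc x ^ (2 - ε) ≤ x ^ (2 - δ) :=
        Real.rpow_le_rpow_of_exponent_le hx (by linarith [min_le_left ε 1])
    _ ≤ ((E : ℝ) * a ^ E * 2 ^ ((k + 1) * a)) ^ (2 - δ) := by
        apply Real.rpow_le_rpow <;> linarith
    _ = ((E : ℝ) * a ^ E) ^ (2 - δ) * ((2 : ℝ) ^ ((k + 1) * a)) ^ (2 - δ) :=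
        Real.mul_rpow (by positivity) (by positivity)
    _ ≤ (2 : ℝ) ^ (a : ℝ) * 2 ^ ((2 * k - 1 : ℝ) * a) := by
        gcongr
        · calc ((E : ℝ) * a ^ E) ^ (2 - δ) ≤ ((E : ℝ) * a ^ E) ^ (2 : ℝ) :=
                Real.rpow_le_rpow_of_exponent_le h1 (by linarith)
            _ ≤ _ := by
                rw [Real.rpow_two, Real.rpow_natCast]
                exact hE'
        · rw [← Real.rpow_natCast, ← Real.rpow_mul two_pos.le]
          refine Real.rpow_le_rpow_of_exponent_le one_le_two ?_
          push_cast
          rw [mul_right_comm]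
          gcongr
          nlinarith
    _ = 2 ^ (2 * k * a) := by
        rw [← Real.rpow_add two_pos, ← Real.rpow_natCast]
        push_cast
        ring_nf

end Asymptotics

end QueryLifting

theorem stmt0 (ε : ℝ) (hε : 0 < ε) (M : ℝ) :
    ∃ (X Y : Type) (_ : Fintype X) (_ : Fintype Y) (F : X → Y → Bool),
      M ≤ Real.logb 2 (partitionNumber F) ∧
      (Real.logb 2 (partitionNumber F)) ^ ((2 : ℝ) - ε) ≤ (Dcc F : ℝ) := by
  obtain ⟨k, hk⟩ := exists_nat_ge (3 / ε + 2)
  have hk3 : 3 / ε ≤ k := by linarith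
  have hk2 : 2 ≤ k := by
    have : (0 : ℝ) < 3 / ε := by positivity
    exact_mod_cast (by linarith : (2 : ℝ) ≤ k)
  rw [div_le_iff₀ hε] at hk3
  obtain ⟨E, hE⟩ := QueryLifting.exists_communication_function k
  obtain ⟨a, ha, haM⟩ := ((QueryLifting.eventually_mul_pow_le_two_pow (E ^ 2) (2 * E)).and
    (Filter.eventually_ge_atTop (⌈M⌉₊ + 1))).exists
  obtain ⟨X, Y, hX, hY, F, hD, hlow, hup⟩ := hE a (by omega)
  refine ⟨X, Y, hX, hY, F, ?_⟩
  have hpos : 0 < partitionNumber F := by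
    have : 0 < 2 ^ (2 * k * a) := by positivity
    omega
  have hlog : ((2 * k * a - 1 : ℕ) : ℝ) ≤ Real.logb 2 (partitionNumber F) := by
    rw [Real.le_logb_iff_rpow_le one_lt_two (by exact_mod_cast hpos), Real.rpow_natCast]
    have : 2 ^ (2 * k * a - 1) ≤ partitionNumber F := by
      have h1 : 2 * k * a = 2 * k * a - 1 + 1 := by
        have : 0 < 2 * k * a := Nat.mul_pos (by omega) (by omega)
        omega
      rw [h1, pow_succ] at hlow
      omega
    exact_mod_cast this
  have haa : a ≤ 2 * k * a - 1 := by
    have : 2 * 2 * a ≤ 2 * k * a := by gcongr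
    omega
  have haR : (a : ℝ) ≤ Real.logb 2 (partitionNumber F) := le_trans (by exact_mod_cast haa) hlog
  have hMa : (⌈M⌉₊ : ℝ) + 1 ≤ a := by exact_mod_cast haM
  have hM := Nat.le_ceil M
  have h0 : (0 : ℝ) ≤ ⌈M⌉₊ := Nat.cast_nonneg _
  refine ⟨by linarith, (QueryLifting.rpow_two_sub_le (k := k) (a := a) (E := E) hε (by linarith)
    hk2 ha (by linarith) ?_).trans (by exact_mod_cast hD)⟩
  rw [Real.logb_le_iff_le_rpow one_lt_two (by exact_mod_cast hpos), Real.rpow_natCast]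
  exact_mod_cast hup
end

section
/- For every ε > 0 and every M, there exists n and a total Boolean function f : {0,1}^n → {0,1} such that UC(f) ≥ M and D(f) ≥ UC(f)^(2−ε). (That is, deterministic query complexity can be nearly quadratically larger than subcube partition complexity, matching the upper bound D(f) = O(UC(f)²) up to lower-order terms.) -/
/-! ### Partial assignments and certificate complexity -/

/-- An input `x` is consistent with a partial assignment `p` if it agrees with
`p` wherever `p` is defined. -/
def Consistent {n : ℕ} (x : Fin n → Bool) (p : Fin n → Option Bool) : Prop :=
  ∀ i : Fin n, ∀ b : Bool, p i = some b → x i = b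

instance {n : ℕ} (x : Fin n → Bool) (p : Fin n → Option Bool) :
    Decidable (Consistent x p) := by unfold Consistent; infer_instance

/-- The width of a partial assignment: the number of fixed coordinates. -/
def paWidth {n : ℕ} (p : Fin n → Option Bool) : ℕ :=
  (Finset.univ.filter (fun i : Fin n => (p i).isSome)).card

/-- `p` is a `b`-certificate for `f`: every input consistent with `p` has value `b`. -/
def IsCert {n : ℕ} (f : (Fin n → Bool) → Bool) (b : Bool) (p : Fin n → Option Bool) : Prop :=
  ∀ x : Fin n → Bool, Consistent x p → f x = b

instance {n : ℕ} (f : (Fin n → Bool) → Bool) (b : Bool) (p : Fin n → Option Bool) :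
    Decidable (IsCert f b p) := by unfold IsCert; infer_instance

/-- The `b`-certificate complexity `C_b(f)`. -/
noncomputable def certC {n : ℕ} (f : (Fin n → Bool) → Bool) (b : Bool) : ℕ :=
  sInf {w : ℕ | ∀ x : Fin n → Bool, f x = b →
    ∃ p : Fin n → Option Bool, IsCert f b p ∧ paWidth p ≤ w ∧ Consistent x p}

/-- The certificate complexity `C(f) = max{C_0(f), C_1(f)}`. -/
noncomputable def certCC {n : ℕ} (f : (Fin n → Bool) → Bool) : ℕ :=
  max (certC f false) (certC f true)

/-- The unambiguous `b`-certificate complexity `UC_b(f)`. -/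
noncomputable def UCb {n : ℕ} (f : (Fin n → Bool) → Bool) (b : Bool) : ℕ :=
  sInf {w : ℕ | ∃ S : Set (Fin n → Option Bool),
    (∀ p ∈ S, IsCert f b p ∧ paWidth p ≤ w) ∧
    ∀ x : Fin n → Bool, f x = b → ∃! p, p ∈ S ∧ Consistent x p}

/-- Subcube partition complexity `UC(f) = max{UC_0(f), UC_1(f)}`. -/
noncomputable def UC {n : ℕ} (f : (Fin n → Bool) → Bool) : ℕ :=
  max (UCb f false) (UCb f true)

/-! ### Decision trees, deterministic and randomized query complexity -/

/-- Deterministic decision trees on `n` bits. -/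
inductive DT (n : ℕ) where
  | leaf : Bool → DT n
  | node : Fin n → DT n → DT n → DT n

/-- Evaluation of a decision tree on an input. -/
def DT.eval {n : ℕ} : DT n → (Fin n → Bool) → Bool
  | .leaf b, _ => b
  | .node i t0 t1, x => if x i then t1.eval x else t0.eval x

/-- Depth of a decision tree. -/
def DT.depth {n : ℕ} : DT n → ℕ
  | .leaf _ => 0
  | .node _ t0 t1 => 1 + max t0.depth t1.depth

/-- Deterministic query complexity `D(f)`. -/
noncomputable def Dquery {n : ℕ} (f : (Fin n → Bool) → Bool) : ℕ :=
  sInf {d : ℕ | ∃ T : DT n, T.depth ≤ d ∧ ∀ x, T.eval x = f x}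

/-! ### An adversary game bounding decision tree depth from below -/

/-- `Hard f d S` says that an adversary restricted to inputs in `S` can keep the value of `f`
undetermined for `d` queries. -/
def Hard {ι : Type} (f : (ι → Bool) → Bool) : ℕ → Set (ι → Bool) → Prop
  | 0, S => S.Nonempty
  | d + 1, S => (∀ b, ∃ x ∈ S, f x = b) ∧ ∀ i, ∃ b, Hard f d {x | x ∈ S ∧ x i = b}

theorem Hard.of_succ {ι : Type} {f : (ι → Bool) → Bool} {d : ℕ} {S : Set (ι → Bool)}
    (h : Hard f (d + 1) S) : Hard f d S := by
  induction d generalizing S with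
  | zero => obtain ⟨x, hx, -⟩ := h.1 true; exact ⟨x, hx⟩
  | succ d ih => exact ⟨h.1, fun i => (h.2 i).imp fun b hb => ih hb⟩

theorem Hard.of_le {ι : Type} {f : (ι → Bool) → Bool} {d e : ℕ} {S : Set (ι → Bool)}
    (hde : d ≤ e) (h : Hard f e S) : Hard f d S := by
  induction e, hde using Nat.le_induction with
  | base => exact h
  | succ e _ ih => exact ih h.of_succ

theorem Hard.nonempty {ι : Type} {f : (ι → Bool) → Bool} {d : ℕ} {S : Set (ι → Bool)}
    (h : Hard f d S) : S.Nonempty := Hard.of_le (Nat.zero_le d) h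

/-- Relabelling the input bits preserves hardness. -/
theorem Hard.relabel {ι κ : Type} (e : ι ≃ κ) {f : (ι → Bool) → Bool} {d : ℕ}
    {S : Set (ι → Bool)} (h : Hard f d S) :
    Hard (fun y : κ → Bool => f (y ∘ e)) d {y | y ∘ e ∈ S} := by
  have lift : ∀ x : ι → Bool, (x ∘ e.symm) ∘ e = x := fun x => by ext; simp
  induction d generalizing S with
  | zero =>
    obtain ⟨x, hx⟩ := h
    exact ⟨x ∘ e.symm, by simpa [lift] using hx⟩
  | succ d ih =>
    refine ⟨fun b => ?_, fun k => ?_⟩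
    · obtain ⟨x, hx, hb⟩ := h.1 b
      exact ⟨x ∘ e.symm, by simpa [lift] using hx, by simpa [lift] using hb⟩
    · obtain ⟨b, hb⟩ := h.2 (e.symm k)
      refine ⟨b, ?_⟩
      simpa using ih hb

theorem Hard.le_depth {n : ℕ} {f : (Fin n → Bool) → Bool} {d : ℕ} {S : Set (Fin n → Bool)}
    (h : Hard f d S) (T : DT n) (hT : ∀ x ∈ S, T.eval x = f x) : d ≤ T.depth := by
  induction T generalizing d S with
  | leaf b =>
    cases d with
    | zero => simp
    | succ d =>
      obtain ⟨x, hx, hb⟩ := h.1 (!b)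
      have := hT x hx
      simp [DT.eval, hb] at this
  | node i t0 t1 ih0 ih1 =>
    cases d with
    | zero => simp
    | succ d =>
      obtain ⟨b, hb⟩ := h.2 i
      simp only [DT.depth]
      cases b with
      | false =>
        have := ih0 hb fun x hx => by
          have := hT x hx.1
          simpa [DT.eval, hx.2] using this
        omega
      | true =>
        have := ih1 hb fun x hx => by
          have := hT x hx.1
          simpa [DT.eval, hx.2] using this
        omega

theorem DT.exists_eval_eq {n : ℕ} (s : Finset (Fin n)) (f : (Fin n → Bool) → Bool)
    (hf : ∀ x y, (∀ i ∈ s, x i = y i) → f x = f y) : ∃ T : DT n, ∀ x, T.eval x = f x := by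
  classical
  induction s using Finset.induction_on generalizing f with
  | empty => exact ⟨.leaf (f fun _ => false), fun x => hf _ _ (by simp)⟩
  | insert i s _ ih =>
    have key : ∀ b, ∃ T : DT n, ∀ x, T.eval x = f (Function.update x i b) := fun b =>
      ih (fun x => f (Function.update x i b)) fun x y hxy => hf _ _ fun j hj => by
        by_cases hji : j = i
        · subst hji; simp
        · simpa [hji] using hxy j (by simpa [hji] using hj)
    obtain ⟨T0, h0⟩ := key false
    obtain ⟨T1, h1⟩ := key true
    refine ⟨.node i T0 T1, fun x => ?_⟩
    cases hx : x i
    · rw [DT.eval, hx, if_neg (by simp), h0, ← hx, Function.update_eq_self]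
    · rw [DT.eval, hx, if_pos rfl, h1, ← hx, Function.update_eq_self]

theorem Hard.le_Dquery {n : ℕ} {f : (Fin n → Bool) → Bool} {d : ℕ} (h : Hard f d Set.univ) :
    d ≤ Dquery f := by
  obtain ⟨T₀, hT₀⟩ := DT.exists_eval_eq Finset.univ f fun x y hxy =>
    congrArg f (funext fun i => hxy i (Finset.mem_univ i))
  obtain ⟨T, hT, hTf⟩ : Dquery f ∈ {d : ℕ | ∃ T : DT n, T.depth ≤ d ∧ ∀ x, T.eval x = f x} :=
    Nat.sInf_mem ⟨T₀.depth, T₀, le_rfl, hT₀⟩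
  exact (h.le_depth T fun x _ => hTf x).trans hT

/-! ### Certificates described by the set of positions they read -/

/-- Every input `x` has a certificate reading at most `c (f x)` positions. -/
def CertLE {ι : Type} (f : (ι → Bool) → Bool) (c : Bool → ℕ) : Prop :=
  ∀ x, ∃ s : Finset ι, s.card ≤ c (f x) ∧ ∀ z, (∀ i ∈ s, z i = x i) → f z = f x

/-- The inputs are partitioned into subcubes on which `f` is constant, a subcube on which `f` is
`b` fixing at most `w b` positions. The subcube of `x` fixes the positions in `φ x`. -/
def UnambLE {ι : Type} (f : (ι → Bool) → Bool) (w : Bool → ℕ) : Prop :=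
  ∃ φ : (ι → Bool) → Finset ι,
    (∀ x z, (∀ i ∈ φ x, z i = x i) → f z = f x ∧ φ z = φ x) ∧ ∀ x, (φ x).card ≤ w (f x)

theorem CertLE.mono {ι : Type} {f : (ι → Bool) → Bool} {c c' : Bool → ℕ} (h : CertLE f c)
    (hc : ∀ b, c b ≤ c' b) : CertLE f c' := fun x =>
  (h x).imp fun _ hs => ⟨hs.1.trans (hc _), hs.2⟩

theorem UnambLE.mono {ι : Type} {f : (ι → Bool) → Bool} {w w' : Bool → ℕ} (h : UnambLE f w)
    (hw : ∀ b, w b ≤ w' b) : UnambLE f w' :=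
  h.imp fun _ hφ => ⟨hφ.1, fun x => (hφ.2 x).trans (hw _)⟩

theorem UnambLE.relabel {ι κ : Type} (e : ι ≃ κ) {f : (ι → Bool) → Bool} {w : Bool → ℕ}
    (h : UnambLE f w) : UnambLE (fun y : κ → Bool => f (y ∘ e)) w := by
  obtain ⟨φ, hφ, hw⟩ := h
  refine ⟨fun y => (φ (y ∘ e)).map e.toEmbedding, fun x z hxz => ?_, fun x => ?_⟩
  · obtain ⟨h1, h2⟩ := hφ (x ∘ e) (z ∘ e) fun i hi => hxz (e i) (by simpa using hi)
    exact ⟨h1, by simp only [h2]⟩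
  · simpa using hw (x ∘ e)

/-- The unambiguous certificates of width at most `w`. -/
theorem UnambLE.exists_partition {n : ℕ} {f : (Fin n → Bool) → Bool} {w : Bool → ℕ}
    (h : UnambLE f w) (b : Bool) : ∃ S : Set (Fin n → Option Bool),
      (∀ p ∈ S, IsCert f b p ∧ paWidth p ≤ w b) ∧
      ∀ x : Fin n → Bool, f x = b → ∃! p, p ∈ S ∧ Consistent x p := by
  classical
  obtain ⟨φ, hφ, hw⟩ := h
  let P : (Fin n → Bool) → Fin n → Option Bool := fun x i => if i ∈ φ x then some (x i) else none
  have hP : ∀ x z, Consistent z (P x) ↔ ∀ i ∈ φ x, z i = x i := fun x z => by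
    refine forall_congr' fun i => ?_
    by_cases hi : i ∈ φ x <;> simp [P, hi]
  refine ⟨{p | ∃ x, f x = b ∧ P x = p}, ?_, fun x hx => ⟨P x, ⟨⟨x, hx, rfl⟩, ?_⟩, ?_⟩⟩
  · rintro _ ⟨x, rfl, rfl⟩
    refine ⟨fun z hz => (hφ x z ((hP x z).1 hz)).1, le_trans (le_of_eq ?_) (hw x)⟩
    unfold paWidth
    congr 1
    ext i
    by_cases hi : i ∈ φ x <;> simp [P, hi]
  · simp [hP]
  · rintro _ ⟨⟨y, hy, rfl⟩, hxy⟩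
    rw [hP] at hxy
    have := (hφ y x hxy).2
    funext i
    by_cases hi : i ∈ φ y
    · simp [P, this, hi, hxy i hi]
    · simp [P, this, hi]

theorem UnambLE.UCb_le {n : ℕ} {f : (Fin n → Bool) → Bool} {w : Bool → ℕ}
    (h : UnambLE f w) (b : Bool) : UCb f b ≤ w b :=
  Nat.sInf_le (h.exists_partition b)

/-! ### Composition with NAND -/

/-- The negated conjunction of `n` copies of `f` on disjoint blocks of input bits. -/
def nandComp {ι : Type} (n : ℕ) (f : (ι → Bool) → Bool) (x : Fin n × ι → Bool) : Bool :=
  !decide (∀ j, f (fun i => x (j, i)) = true)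

theorem nandComp_eq_false {ι : Type} {n : ℕ} {f : (ι → Bool) → Bool} {x : Fin n × ι → Bool} :
    nandComp n f x = false ↔ ∀ j, f (fun i => x (j, i)) = true := by
  simp [nandComp]

theorem nandComp_eq_true {ι : Type} {n : ℕ} {f : (ι → Bool) → Bool} {x : Fin n × ι → Bool} :
    nandComp n f x = true ↔ ∃ j, f (fun i => x (j, i)) = false := by
  simp [nandComp]

theorem CertLE.nandComp {ι : Type} {f : (ι → Bool) → Bool} {c : Bool → ℕ} (h : CertLE f c)
    (n : ℕ) : CertLE (nandComp n f) (fun b => if b then c false else n * c true) := by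
  classical
  intro x
  cases hx : _root_.nandComp n f x with
  | false =>
    rw [nandComp_eq_false] at hx
    choose s hs hcert using fun j : Fin n => h fun i => x (j, i)
    refine ⟨Finset.univ.biUnion fun j => (s j).image fun i => (j, i), ?_, fun z hz => ?_⟩
    · refine Finset.card_biUnion_le.trans ((Finset.sum_le_card_nsmul _ _ (c true) ?_).trans ?_)
      · intro j _
        exact Finset.card_image_le.trans (by simpa [hx j] using hs j)
      · simp
    · rw [nandComp_eq_false]
      intro j
      rw [hcert j _ fun i hi => hz (j, i) (by simpa using hi), hx j]
  | true =>
    rw [nandComp_eq_true] at hx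
    obtain ⟨j, hj⟩ := hx
    obtain ⟨s, hs, hcert⟩ := h fun i => x (j, i)
    refine ⟨s.image fun i => (j, i), ?_, fun z hz => ?_⟩
    · exact Finset.card_image_le.trans (by simpa [hj] using hs)
    · rw [nandComp_eq_true]
      exact ⟨j, by rw [hcert _ fun i hi => hz (j, i) (by simpa using hi), hj]⟩

theorem UnambLE.nandComp {ι : Type} {f : (ι → Bool) → Bool} {w : Bool → ℕ} (h : UnambLE f w)
    (n : ℕ) :
    UnambLE (nandComp n f) (fun b => if b then n * w true + w false else n * w true) := by
  classical
  obtain ⟨φ, hφ, hw⟩ := h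
  let J : (Fin n × ι → Bool) → Finset (Fin n) := fun x =>
    Finset.univ.filter fun j => ∀ k < j, f (fun i => x (k, i)) = true
  refine ⟨fun x => (J x).biUnion fun j => (φ fun i => x (j, i)).image fun i => (j, i),
    fun x z hxz => ?_, fun x => ?_⟩
  · have key : ∀ j ∈ J x, f (fun i => z (j, i)) = f (fun i => x (j, i)) ∧
        φ (fun i => z (j, i)) = φ fun i => x (j, i) := fun j hj =>
      hφ _ _ fun i hi => hxz (j, i) (by simpa using ⟨hj, hi⟩)
    have down : ∀ y j k, j ∈ J y → k < j → k ∈ J y := fun y j k hj hk => by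
      simp only [J, Finset.mem_filter, Finset.mem_univ, true_and] at hj ⊢
      exact fun l hl => hj l (hl.trans hk)
    have hJ : J z = J x := by
      ext j
      induction j using WellFoundedLT.induction with
      | ind j ih =>
        have hk : ∀ y, j ∈ J y → ∀ k < j, f (fun i => y (k, i)) = true := fun y hj => by
          simpa [J] using hj
        refine ⟨fun hj => ?_, fun hj => ?_⟩
        · simp only [J, Finset.mem_filter, Finset.mem_univ, true_and]
          intro k hkj
          rw [← (key k ((ih k hkj).1 (down z j k hj hkj))).1, hk z hj k hkj]
        · simp only [J, Finset.mem_filter, Finset.mem_univ, true_and]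
          intro k hkj
          rw [(key k (down x j k hj hkj)).1, hk x hj k hkj]
    refine ⟨?_, ?_⟩
    · have hall : ∀ y, (∀ j, f (fun i => y (j, i)) = true) → ∀ j, j ∈ J y := fun y hy j => by
        simp [J, hy]
      have : (∀ j, f (fun i => z (j, i)) = true) ↔ ∀ j, f (fun i => x (j, i)) = true :=
        ⟨fun hz j => by rw [← (key j (hJ ▸ hall z hz j)).1, hz j],
          fun hx j => by rw [(key j (hall x hx j)).1, hx j]⟩
      simp only [_root_.nandComp, this]
    · simp only [hJ]
      exact Finset.biUnion_congr rfl fun j hj => by rw [(key j hj).2]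
  · have hcard : ((J x).biUnion fun j => (φ fun i => x (j, i)).image fun i => (j, i)).card ≤
        ∑ j ∈ J x, w (f fun i => x (j, i)) :=
      Finset.card_biUnion_le.trans
        (Finset.sum_le_sum fun j _ => Finset.card_image_le.trans (hw _))
    refine hcard.trans ?_
    cases hx : _root_.nandComp n f x with
    | false =>
      rw [nandComp_eq_false] at hx
      simp [J, hx]
    | true =>
      have hle : ∀ j ∈ J x, w (f fun i => x (j, i)) ≤
          w true + if f (fun i => x (j, i)) = false then w false else 0 := fun j _ => by
        cases f (fun i => x (j, i)) <;> simp
      refine (Finset.sum_le_sum hle).trans ?_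
      rw [Finset.sum_add_distrib, ← Finset.sum_filter, Finset.sum_const, Finset.sum_const,
        smul_eq_mul, smul_eq_mul]
      have h1 : (J x).card ≤ n := (Finset.card_le_univ _).trans (by simp)
      have h2 : ((J x).filter fun j => f (fun i => x (j, i)) = false).card ≤ 1 := by
        refine Finset.card_le_one.2 fun j hj k hk => ?_
        simp only [J, Finset.mem_filter, Finset.mem_univ, true_and] at hj hk
        by_contra hne
        rcases lt_or_gt_of_ne hne with hlt | hlt
        · simpa [hj.2] using hk.1 j hlt
        · simpa [hk.2] using hj.1 k hlt
      simpa using Nat.add_le_add (Nat.mul_le_mul_right (w true) h1)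
        (Nat.mul_le_mul_right (w false) h2)

theorem Hard.exists_true {ι : Type} {f : (ι → Bool) → Bool} {d : ℕ} {S : Set (ι → Bool)}
    (h : Hard f d S) (h0 : d = 0 → ∀ x ∈ S, f x = true) : ∃ x ∈ S, f x = true := by
  cases d with
  | zero =>
    obtain ⟨x, hx⟩ := h.nonempty
    exact ⟨x, hx, h0 rfl x hx⟩
  | succ d => exact h.1 true

/-- After a query the adversary can keep the hardness from dropping by more than one, in such a
way that `f` is constantly `true` once the hardness has been exhausted. -/
theorem Hard.exists_answer {ι : Type} {f : (ι → Bool) → Bool} {d : ℕ} {S : Set (ι → Bool)}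
    (h : Hard f d S) (h0 : d = 0 → ∀ x ∈ S, f x = true) (i : ι) :
    ∃ b e, Hard f e {x | x ∈ S ∧ x i = b} ∧ d ≤ e + 1 ∧
      (e = 0 → ∀ x ∈ S, x i = b → f x = true) := by
  match d, h with
  | 0, h =>
    obtain ⟨x, hx⟩ := h.nonempty
    exact ⟨x i, 0, ⟨x, hx, rfl⟩, by omega, fun _ z hz _ => h0 rfl z hz⟩
  | 1, h =>
    obtain ⟨x, hx, hfx⟩ := h.1 true
    by_cases hall : ∀ z ∈ S, z i = x i → f z = true
    · exact ⟨x i, 0, ⟨x, hx, rfl⟩, le_rfl, fun _ => hall⟩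
    · push Not at hall
      obtain ⟨z, hz, hzi, hfz⟩ := hall
      refine ⟨x i, 1, ⟨fun b => ?_, fun k => ?_⟩, by omega, by simp⟩
      · cases b
        · exact ⟨z, ⟨hz, hzi⟩, by simpa using hfz⟩
        · exact ⟨x, ⟨hx, rfl⟩, hfx⟩
      · exact ⟨x k, x, ⟨hx, rfl⟩, rfl⟩
  | d + 2, h =>
    obtain ⟨b, hb⟩ := h.2 i
    exact ⟨b, d + 1, hb, le_rfl, by simp⟩

theorem Hard.nandComp_of_blocks {ι : Type} {n : ℕ} {f : (ι → Bool) → Bool} {m : ℕ}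
    (d : Fin n → ℕ) (S : Fin n → Set (ι → Bool)) (hS : ∀ j, Hard f (d j) (S j))
    (h0 : ∀ j, d j = 0 → ∀ x ∈ S j, f x = true) (hm : m ≤ ∑ j, d j)
    (R : Set (Fin n × ι → Bool)) (hR : ∀ x, (∀ j, (fun i => x (j, i)) ∈ S j) → x ∈ R) :
    Hard (nandComp n f) m R := by
  classical
  induction m generalizing d S R with
  | zero =>
    choose y hy using fun j => (hS j).nonempty
    exact ⟨fun p => y p.1 p.2, hR _ hy⟩
  | succ m ih =>
    refine ⟨?_, ?_⟩
    · choose y hyS hy using fun j => (hS j).exists_true (h0 j)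
      intro b
      cases b with
      | false => exact ⟨fun p => y p.1 p.2, hR _ hyS, nandComp_eq_false.2 hy⟩
      | true =>
        obtain ⟨j, hj⟩ : ∃ j, d j ≠ 0 := by
          by_contra! hd
          simp [hd] at hm
        obtain ⟨e, he⟩ := Nat.exists_eq_succ_of_ne_zero hj
        have hSj := hS j
        rw [he] at hSj
        obtain ⟨z, hz, hfz⟩ := hSj.1 false
        refine ⟨fun p => Function.update y j z p.1 p.2, hR _ fun k => ?_,
          nandComp_eq_true.2 ⟨j, by simpa using hfz⟩⟩
        by_cases hk : k = j
        · subst hk; simpa using hz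
        · simpa [hk] using hyS k
    · rintro ⟨j, i⟩
      obtain ⟨b, e, he, hde, hone⟩ := (hS j).exists_answer (h0 j) i
      refine ⟨b, ih (Function.update d j e)
        (Function.update S j {x | x ∈ S j ∧ x i = b}) ?_ ?_ ?_ _ ?_⟩
      · intro k
        by_cases hk : k = j
        · subst hk; simpa using he
        · simpa [hk] using hS k
      · intro k
        by_cases hk : k = j
        · subst hk; simpa using hone
        · simpa [hk] using h0 k
      · rw [Finset.sum_update_of_mem (Finset.mem_univ j)]
        rw [← Finset.add_sum_erase _ _ (Finset.mem_univ j), Finset.erase_eq] at hm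
        omega
      · intro x hx
        have hxj := hx j
        simp only [Function.update_self] at hxj
        refine ⟨hR x fun k => ?_, hxj.2⟩
        by_cases hk : k = j
        · subst hk; exact hxj.1
        · simpa [hk] using hx k

theorem Hard.nandComp {ι : Type} {f : (ι → Bool) → Bool} {d : ℕ} (h : Hard f d Set.univ)
    (hd : d ≠ 0) (n : ℕ) : Hard (nandComp n f) (n * d) Set.univ :=
  Hard.nandComp_of_blocks (fun _ => d) (fun _ => Set.univ) (fun _ => h) (fun _ h => absurd h hd)
    (by simp) _ fun _ _ => Set.mem_univ _

/-! ### The cheat sheet construction -/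

/-- The input bits of a cheat sheet function: `c` inputs of the original function, and for each of
the `2 ^ c` possible tuples of answers a cell consisting of a flag and, for each of the `c` inputs,
`C` pointers of `L` bits each. -/
abbrev CSIndex (ι : Type) (c C L : ℕ) : Type :=
  (Fin c × ι) ⊕ ((Fin c → Bool) × Option (Fin c × Fin C × Fin L))

section CheatSheet

variable {ι : Type} {c C L : ℕ}

/-- The answers of the `c` inputs of the original function. -/
def csAddr (f : (ι → Bool) → Bool) (x : CSIndex ι c C L → Bool) : Fin c → Bool :=
  fun i => f fun v => x (.inl (i, v))

/-- The pointers stored in the cell `l`. -/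
def csPtr (e : (Fin L → Bool) → ι) (x : CSIndex ι c C L → Bool) (l : Fin c → Bool)
    (q : Fin c × Fin C) : ι :=
  e fun b => x (.inr (l, some (q.1, q.2, b)))

/-- The cell `l` certifies the answers of all `c` inputs. -/
def csValid (f : (ι → Bool) → Bool) (e : (Fin L → Bool) → ι) (x : CSIndex ι c C L → Bool)
    (l : Fin c → Bool) : Prop :=
  x (.inr (l, none)) = true ∧ ∀ i, ∀ z : ι → Bool,
    (∀ t : Fin C, z (csPtr e x l (i, t)) = x (.inl (i, csPtr e x l (i, t)))) → f z = l i

open Classical in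
/-- The cheat sheet function: the cell addressed by the answers certifies these answers. -/
noncomputable def csFun (f : (ι → Bool) → Bool) (e : (Fin L → Bool) → ι)
    (x : CSIndex ι c C L → Bool) : Bool :=
  decide (csValid f e x (csAddr f x))

open Classical in
/-- The positions read to evaluate the validity of the cell `l`. -/
noncomputable def csRead (e : (Fin L → Bool) → ι) (x : CSIndex ι c C L → Bool)
    (l : Fin c → Bool) : Finset (CSIndex ι c C L) :=
  Finset.univ.image (fun o => .inr (l, o)) ∪
    Finset.univ.image fun q : Fin c × Fin C => .inl (q.1, csPtr e x l q)

theorem card_csRead_le (e : (Fin L → Bool) → ι) (x : CSIndex ι c C L → Bool)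
    (l : Fin c → Bool) : (csRead e x l).card ≤ c * C * (L + 1) + 1 := by
  classical
  refine (Finset.card_union_le _ _).trans ((Nat.add_le_add Finset.card_image_le
    Finset.card_image_le).trans (le_of_eq ?_))
  simp
  ring

theorem csRead_stable {f : (ι → Bool) → Bool} {e : (Fin L → Bool) → ι}
    {x z : CSIndex ι c C L → Bool} {l : Fin c → Bool} (h : ∀ p ∈ csRead e x l, z p = x p) :
    csRead e z l = csRead e x l ∧ (csValid f e z l ↔ csValid f e x l) := by
  have hcell : ∀ o, z (.inr (l, o)) = x (.inr (l, o)) := fun o => h _ (by simp [csRead])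
  have hptr : csPtr e z l = csPtr e x l := by
    funext q
    simp [csPtr, hcell]
  have hval : ∀ q : Fin c × Fin C,
      z (.inl (q.1, csPtr e x l q)) = x (.inl (q.1, csPtr e x l q)) := fun q =>
    h _ (by simp [csRead])
  refine ⟨by simp only [csRead, hptr], ?_⟩
  simp only [csValid, hptr, hcell, fun i t => hval (i, t)]

/-- A valid cell pins down the address. -/
theorem csAddr_eq_of_valid {f : (ι → Bool) → Bool} {e : (Fin L → Bool) → ι}
    {x z : CSIndex ι c C L → Bool} {l : Fin c → Bool} (h : ∀ p ∈ csRead e x l, z p = x p)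
    (hx : csValid f e x l) : csAddr f z = l :=
  funext fun i => hx.2 i _ fun t => h _ (by simp [csRead])

theorem csFun_eq_of_addr {f : (ι → Bool) → Bool} {e : (Fin L → Bool) → ι}
    {x z : CSIndex ι c C L → Bool} (h : ∀ p ∈ csRead e x (csAddr f x), z p = x p)
    (ha : csAddr f z = csAddr f x) : csFun f e z = csFun f e x := by
  rw [csFun, csFun, decide_eq_decide, ha, (csRead_stable h).2]

theorem CertLE.csFun {f : (ι → Bool) → Bool} (h : CertLE f fun _ => C)
    (e : (Fin L → Bool) → ι) :
    CertLE (csFun (c := c) (C := C) f e) fun _ => c * C * (L + 2) + 1 := by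
  classical
  intro x
  choose s hs hcert using fun i : Fin c => h fun v => x (.inl (i, v))
  refine ⟨csRead e x (csAddr f x) ∪ Finset.univ.biUnion fun i => (s i).image fun v => .inl (i, v),
    ?_, fun z hz => ?_⟩
  · have h2 : (Finset.univ.biUnion fun i => (s i).image fun v =>
        (.inl (i, v) : CSIndex ι c C L)).card ≤ c * C :=
      Finset.card_biUnion_le.trans ((Finset.sum_le_card_nsmul _ _ C fun i _ =>
        Finset.card_image_le.trans (hs i)).trans (by simp))
    refine (Finset.card_union_le _ _).trans
      ((Nat.add_le_add (card_csRead_le _ _ _) h2).trans (le_of_eq ?_))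
    ring
  · refine csFun_eq_of_addr (fun p hp => hz p (Finset.mem_union_left _ hp)) (funext fun i => ?_)
    exact hcert i _ fun v hv => hz _ (Finset.mem_union_right _ (by simpa using hv))

theorem UnambLE.csFun {f : (ι → Bool) → Bool} {W : ℕ} (h : UnambLE f fun _ => W)
    (e : (Fin L → Bool) → ι) :
    UnambLE (csFun (c := c) (C := C) f e) fun b =>
      c * C * (L + 1) + 1 + if b then 0 else c * W := by
  classical
  obtain ⟨φ, hφ, hW⟩ := h
  let Φ : (CSIndex ι c C L → Bool) → Finset (CSIndex ι c C L) := fun x =>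
    Finset.univ.biUnion fun i : Fin c =>
      (φ fun v => x (.inl (i, v))).image fun v => .inl (i, v)
  refine ⟨fun x => csRead e x (csAddr f x) ∪ if _root_.csFun f e x then ∅ else Φ x,
    fun x z hxz => ?_, fun x => ?_⟩
  · have hread : ∀ p ∈ csRead e x (csAddr f x), z p = x p := fun p hp =>
      hxz p (Finset.mem_union_left _ hp)
    suffices ha : csAddr f z = csAddr f x ∧ (_root_.csFun f e x = false → Φ z = Φ x) by
      have hf := csFun_eq_of_addr hread ha.1
      refine ⟨hf, ?_⟩
      simp only [ha.1, hf, (csRead_stable (f := f) hread).1]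
      cases hx : _root_.csFun f e x
      · simp [ha.2 hx]
      · simp
    cases hx : _root_.csFun f e x with
    | true => exact ⟨csAddr_eq_of_valid hread (by simpa [_root_.csFun] using hx), by simp⟩
    | false =>
      have key := fun i : Fin c => hφ (fun v => x (.inl (i, v))) (fun v => z (.inl (i, v)))
        fun v hv => hxz _ (Finset.mem_union_right _ (by simpa [hx, Φ] using hv))
      exact ⟨funext fun i => (key i).1, fun _ =>
        Finset.biUnion_congr rfl fun i _ => by rw [(key i).2]⟩
  · refine (Finset.card_union_le _ _).trans (Nat.add_le_add (card_csRead_le _ _ _) ?_)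
    cases hx : _root_.csFun f e x with
    | true => simp
    | false =>
      simpa [Φ] using Finset.card_biUnion_le.trans ((Finset.sum_le_card_nsmul _ _ W fun i _ =>
        Finset.card_image_le.trans (hW _)).trans (by simp))

/-- A certificate of size at most `C` can be listed by `C` pointers. -/
theorem CertLE.exists_pointers [Nonempty ι] {f : (ι → Bool) → Bool} (h : CertLE f fun _ => C)
    (x : ι → Bool) : ∃ p : Fin C → ι, ∀ z, (∀ t, z (p t) = x (p t)) → f z = f x := by
  obtain ⟨s, hs, hcert⟩ := h x
  refine ⟨fun t => if ht : t.1 < s.card then (s.equivFin.symm ⟨t, ht⟩ : s) else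
    Classical.arbitrary ι, fun z hz => hcert z fun i hi => ?_⟩
  have := (s.equivFin ⟨i, hi⟩).2
  simpa [this] using hz ⟨s.equivFin ⟨i, hi⟩, this.trans_le hs⟩

theorem Hard.csFun_of_blocks [Nonempty ι] {f : (ι → Bool) → Bool} (hf : CertLE f fun _ => C)
    {e : (Fin L → Bool) → ι} (he : Function.Surjective e) {d : ℕ}
    (S : Fin c → Set (ι → Bool)) (hS : ∀ i, Hard f d (S i)) (Q : Finset (Fin c → Bool))
    (hQ : d + Q.card ≤ 2 ^ c) (R : Set (CSIndex ι c C L → Bool))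
    (hR : ∀ x : CSIndex ι c C L → Bool, (∀ i, (fun v => x (.inl (i, v))) ∈ S i) →
      (∀ l ∈ Q, ∀ o, x (.inr (l, o)) = false) → x ∈ R) :
    Hard (csFun f e) d R := by
  classical
  induction d generalizing S Q R with
  | zero =>
    choose y hy using fun i => (hS i).nonempty
    exact ⟨Sum.elim (fun p => y p.1 p.2) fun _ => false, hR _ hy (by simp)⟩
  | succ d ih =>
    refine ⟨fun b => ?_, ?_⟩
    · obtain ⟨l, hl⟩ : ∃ l, l ∉ Q := by
        by_contra! hall
        have : Q = Finset.univ := Finset.eq_univ_iff_forall.2 hall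
        simp [this] at hQ
      choose y hyS hy using fun i => (hS i).1 (l i)
      choose p hp using fun i => hf.exists_pointers (y i)
      choose enc henc using he
      let x : CSIndex ι c C L → Bool := Sum.elim (fun q => y q.1 q.2) fun q =>
        if q.1 = l then q.2.elim b fun r => enc (p r.1 r.2.1) r.2.2 else false
      have haddr : csAddr f x = l := funext hy
      have hptr : ∀ q, csPtr e x l q = p q.1 q.2 := fun q => by simp [csPtr, x, henc]
      refine ⟨x, hR x hyS fun k hk o => ?_, ?_⟩
      · have : k ≠ l := fun h => hl (h ▸ hk)
        simp [x, this]
      · have hflag : x (.inr (l, none)) = b := by simp [x]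
        cases b with
        | false => simp [csFun, haddr, csValid, hflag]
        | true =>
          simp only [csFun, haddr, csValid, hflag, decide_eq_true_eq, true_and, hptr]
          intro i z hz
          rw [← hy i]
          exact hp i z hz
    · rintro (⟨i, v⟩ | ⟨l, o⟩)
      · obtain ⟨b, hb⟩ := (hS i).2 v
        refine ⟨b, ih (Function.update S i {x | x ∈ S i ∧ x v = b}) ?_ Q (by omega) _ ?_⟩
        · intro k
          by_cases hk : k = i
          · subst hk; simpa using hb
          · simpa [hk] using (hS k).of_succ
        · intro x hx hxQ
          have hxi := hx i
          simp only [Function.update_self] at hxi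
          refine ⟨hR x (fun k => ?_) hxQ, hxi.2⟩
          by_cases hk : k = i
          · subst hk; exact hxi.1
          · simpa [hk] using hx k
      · refine ⟨false, ih S (fun k => (hS k).of_succ) (insert l Q) ?_ _ ?_⟩
        · have := Finset.card_insert_le l Q
          omega
        · exact fun x hx hxQ => ⟨hR x hx fun k hk => hxQ k (Finset.mem_insert_of_mem hk),
            hxQ l (Finset.mem_insert_self l Q) o⟩

theorem Hard.csFun [Nonempty ι] {f : (ι → Bool) → Bool} (hf : CertLE f fun _ => C)
    {e : (Fin L → Bool) → ι} (he : Function.Surjective e) {d : ℕ} (h : Hard f d Set.univ)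
    (hd : d ≤ 2 ^ c) : Hard (csFun (c := c) (C := C) f e) d Set.univ :=
  Hard.csFun_of_blocks hf he (fun _ => Set.univ) (fun _ => h) ∅ (by simpa using hd) _
    fun _ _ _ => Set.mem_univ _

end CheatSheet

/-! ### Lower bounds on unambiguous certificate complexity -/

theorem UnambLE.le_UCb {n : ℕ} {f : (Fin n → Bool) → Bool} {w : Bool → ℕ} (h : UnambLE f w)
    {m : ℕ} (x : Fin n → Bool)
    (hx : ∀ s : Finset (Fin n), (∀ z, (∀ i ∈ s, z i = x i) → f z = f x) → m ≤ s.card) :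
    m ≤ UCb f (f x) := by
  obtain ⟨S, hS, hex⟩ : UCb f (f x) ∈ {w : ℕ | ∃ S : Set (Fin n → Option Bool),
      (∀ p ∈ S, IsCert f (f x) p ∧ paWidth p ≤ w) ∧
      ∀ y : Fin n → Bool, f y = f x → ∃! p, p ∈ S ∧ Consistent y p} :=
    Nat.sInf_mem ⟨w (f x), h.exists_partition (f x)⟩
  obtain ⟨p, ⟨hp, hxp⟩, -⟩ := hex x rfl
  refine (hx _ fun z hz => (hS p hp).1 z fun i b hib => ?_).trans (hS p hp).2
  rw [hz i (by simp [hib]), hxp i b hib]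

theorem nandComp_card_cert {ι : Type} {f : (ι → Bool) → Bool} {y z : ι → Bool}
    (hz : f z = false) {n : ℕ} (s : Finset (Fin n × ι))
    (hs : ∀ x, (∀ p ∈ s, x p = y p.2) → nandComp n f x = false) : n ≤ s.card := by
  classical
  have himage : s.image Prod.fst = Finset.univ := by
    refine Finset.eq_univ_iff_forall.2 fun j => ?_
    by_contra hj
    have hx := hs (fun p => Function.update (fun _ => y) j z p.1 p.2) fun p hp => by
      have : p.1 ≠ j := fun h => hj (h ▸ Finset.mem_image_of_mem _ hp)
      simp [this]
    have := nandComp_eq_false.1 hx j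
    simp [hz] at this
  simpa [himage] using Finset.card_image_le (s := s) (f := Prod.fst)

/-! ### Iterating the construction -/

/-- Two NAND compositions followed by a cheat sheet. -/
theorem exists_csFun_nandComp_nandComp {ι : Type} [Fintype ι] [Nonempty ι]
    {f : (ι → Bool) → Bool} {C W₀ W₁ d : ℕ} (hC : CertLE f fun _ => C)
    (hW : UnambLE f fun b => if b then W₁ else W₀) (hf : Hard f d Set.univ) (hd : d ≠ 0)
    {n c L : ℕ} (hn : n ≠ 0) (hL : n * (n * Fintype.card ι) ≤ 2 ^ L)
    (hc : n * (n * d) ≤ 2 ^ c) :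
    ∃ (κ : Type) (_ : Fintype κ) (_ : Nonempty κ) (g : (κ → Bool) → Bool),
      Fintype.card κ = c * (n * (n * Fintype.card ι)) + 2 ^ c * (c * (n * C * L) + 1) ∧
      (CertLE g fun _ => c * (n * C) * (L + 2) + 1) ∧
      (UnambLE g fun b => c * (n * C) * (L + 1) + 1 +
        if b then 0 else c * (n * (n * W₁ + W₀) + n * W₁)) ∧
      Hard g (n * (n * d)) Set.univ := by
  have : NeZero n := ⟨hn⟩
  have hC' : CertLE (nandComp n (nandComp n f)) fun _ => n * C :=
    ((hC.nandComp n).nandComp n).mono fun b => by cases b <;> simp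
  have hW' : UnambLE (nandComp n (nandComp n f)) fun _ => n * (n * W₁ + W₀) + n * W₁ :=
    ((hW.nandComp n).nandComp n).mono fun b => by cases b <;> simp
  have hf' := (hf.nandComp hd n).nandComp (Nat.mul_ne_zero hn hd) n
  obtain ⟨e, he⟩ : ∃ e : (Fin L → Bool) → Fin n × Fin n × ι, Function.Surjective e := by
    obtain ⟨i⟩ := Function.Embedding.nonempty_of_card_le
      (α := Fin n × Fin n × ι) (β := Fin L → Bool) (by simpa using hL)
    exact ⟨Function.invFun i, Function.invFun_surjective i.injective⟩
  refine ⟨CSIndex (Fin n × Fin n × ι) c (n * C) L, inferInstance, ⟨.inr (fun _ => false, none)⟩,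
    csFun (nandComp n (nandComp n f)) e, ?_, hC'.csFun e, hW'.csFun e, hf'.csFun hC' he hc⟩
  simp

/-- A bound on the growth of the polynomial factors in one round of the construction. -/
theorem exists_mul_pow_le (A : ℕ) (k : ℕ) : ∃ A' : ℕ, ∀ m : ℕ, 1 ≤ m →
    (2 * m * (k + 1) * ((A + 2) * m + 2) + 1 + 6 * m * (k + 1)) * (A * m) ^ A ≤ (A' * m) ^ A' ∧
    3 * (2 * m * (k + 1)) + (A + 2) * m + A * m * A + 2 ≤ A' * m := by
  refine ⟨20 * (k + 1) * (A + 4) + A * A, fun m hm => ?_⟩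
  set A' := 20 * (k + 1) * (A + 4) + A * A with hA'
  have hmm : m ≤ m * m := Nat.le_mul_self m
  have hA2 : A + 2 ≤ A' := by nlinarith
  constructor
  · have h1 : (A * m) ^ A ≤ (A' * m) ^ A :=
      Nat.pow_le_pow_left (Nat.mul_le_mul_right m (by omega)) A
    have h2 : 2 * m * (k + 1) * ((A + 2) * m + 2) + 1 + 6 * m * (k + 1) ≤ (A' * m) ^ 2 := by
      have h3 : 2 * m * (k + 1) * ((A + 2) * m + 2) + 1 + 6 * m * (k + 1) ≤ A' * (m * m) := by
        have : 2 * m * (k + 1) * ((A + 2) * m + 2) + 1 + 6 * m * (k + 1) =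
          2 * (k + 1) * (A + 2) * (m * m) + 10 * (k + 1) * m + 1 := by ring
        rw [this]
        have h4 : 10 * (k + 1) * m ≤ 10 * (k + 1) * (m * m) := Nat.mul_le_mul_left _ hmm
        have h5 : 2 * (k + 1) * (A + 2) + 10 * (k + 1) + 1 ≤ A' := by nlinarith
        have h6 := Nat.mul_le_mul_right (m * m) h5
        nlinarith
      refine h3.trans ?_
      have : (A' * m) ^ 2 = A' * A' * (m * m) := by ring
      rw [this]
      exact Nat.mul_le_mul_right _ (Nat.le_mul_self A')
    calc _ ≤ (A' * m) ^ 2 * (A' * m) ^ A := Nat.mul_le_mul h2 h1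
      _ = (A' * m) ^ (A + 2) := by ring
      _ ≤ (A' * m) ^ A' := Nat.pow_le_pow_right (by nlinarith) hA2
  · have h5 : 6 * (k + 1) + (A + 2) + A * A + 2 ≤ A' := by nlinarith
    have h6 := Nat.mul_le_mul_right m h5
    nlinarith

theorem exists_hard_with_small_certificates (k : ℕ) : ∃ A : ℕ, ∀ m : ℕ, 1 ≤ m →
    ∃ (ι : Type) (_ : Fintype ι) (_ : Nonempty ι) (f : (ι → Bool) → Bool),
      Fintype.card ι ≤ 2 ^ (A * m) ∧
      (CertLE f fun _ => (A * m) ^ A * 2 ^ (m * k)) ∧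
      (UnambLE f fun b =>
        if b then (A * m) ^ A * 2 ^ (m * k) else (A * m) ^ A * 2 ^ (m * (k + 1))) ∧
      Hard f (2 ^ (2 * m * k)) Set.univ := by
  induction k with
  | zero =>
    refine ⟨1, fun m hm => ⟨Unit, inferInstance, inferInstance, fun x => x (), ?_, ?_, ?_, ?_⟩⟩
    · simpa using Nat.one_le_two_pow
    · exact fun x => ⟨{()}, by simpa using hm, fun z hz => hz () (by simp)⟩
    · refine ⟨fun _ => {()}, fun x z hz => ⟨hz () (by simp), rfl⟩, fun x => ?_⟩
      have : 1 * 1 ≤ m * 2 ^ m := Nat.mul_le_mul hm Nat.one_le_two_pow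
      by_cases hx : x () <;> simp [hx] <;> omega
    · exact ⟨fun b => ⟨fun _ => b, trivial, rfl⟩, fun i => ⟨true, fun _ => true, by simp⟩⟩
  | succ k ih =>
    obtain ⟨A, hA⟩ := ih
    obtain ⟨A', hA'⟩ := exists_mul_pow_le A k
    refine ⟨A', fun m hm => ?_⟩
    obtain ⟨hq', hexp⟩ := hA' m hm
    obtain ⟨ι, _, _, f, hcard, hC, hW, hf⟩ := hA m hm
    have hL : 2 ^ m * (2 ^ m * Fintype.card ι) ≤ 2 ^ ((A + 2) * m) := by
      calc _ ≤ 2 ^ m * (2 ^ m * 2 ^ (A * m)) := by gcongr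
        _ = _ := by ring
    have hc : 2 ^ m * (2 ^ m * 2 ^ (2 * m * k)) ≤ 2 ^ (2 * m * (k + 1)) := le_of_eq (by ring)
    obtain ⟨κ, i1, i2, g, gcard, gC, gW, gf⟩ := exists_csFun_nandComp_nandComp hC hW hf
      (by positivity) (by positivity) hL hc
    have hq1 : 1 ≤ (A * m) ^ A := by
      rcases Nat.eq_zero_or_pos A with rfl | hA0
      · simp
      · exact Nat.one_le_pow _ _ (Nat.mul_pos hA0 hm)
    have hqexp : (A * m) ^ A ≤ 2 ^ (A * m * A) := by
      rw [pow_mul]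
      exact Nat.pow_le_pow_left Nat.lt_two_pow_self.le A
    have hbound : ∀ n P : ℕ, 1 ≤ n → 1 ≤ P →
        2 * m * (k + 1) * (n * ((A * m) ^ A * P)) * ((A + 2) * m + 2) + 1 ≤
          (A' * m) ^ A' * (n * P) ∧
        2 * m * (k + 1) * (n * ((A * m) ^ A * P)) * ((A + 2) * m + 1) + 1 +
          2 * m * (k + 1) * (n * (n * ((A * m) ^ A * P) + (A * m) ^ A * (n * P)) +
            n * ((A * m) ^ A * P)) ≤ (A' * m) ^ A' * (n * (n * P)) := by
      intro n P hn hP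
      rw [show 6 * m * (k + 1) = 3 * (2 * m * (k + 1)) by ring] at hq'
      generalize (A * m) ^ A = q at *
      generalize (A' * m) ^ A' = q' at *
      generalize 2 * m * (k + 1) = c at *
      generalize (A + 2) * m = L at *
      have hone : 1 ≤ q * (n * P) := Nat.mul_pos hq1 (Nat.mul_pos hn hP)
      have hle : q * (n * P) ≤ q * (n * (n * P)) :=
        Nat.mul_le_mul_left _ (Nat.le_mul_of_pos_left _ hn)
      constructor
      · refine le_trans ?_ (Nat.mul_le_mul_right (n * P) hq')
        nlinarith [Nat.zero_le (3 * c * (q * (n * P)))]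
      · refine le_trans ?_ (Nat.mul_le_mul_right (n * (n * P)) hq')
        nlinarith [Nat.mul_le_mul_left (c * (L + 2)) hle]
    refine ⟨κ, i1, i2, g, ?_, gC.mono fun b => ?_, gW.mono fun b => ?_, ?_⟩
    · rw [gcard]
      refine le_trans ?_ (Nat.pow_le_pow_right two_pos hexp)
      set c := 2 * m * (k + 1) with hcdef
      set L := (A + 2) * m
      have hnP : 2 ^ m * 2 ^ (m * k) ≤ 2 ^ c := by
        rw [← pow_add]
        exact Nat.pow_le_pow_right two_pos (by rw [hcdef]; nlinarith)
      have hc2 : c ≤ 2 ^ c := Nat.lt_two_pow_self.le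
      have hL2 : L ≤ 2 ^ L := Nat.lt_two_pow_self.le
      have h1 : c * (2 ^ m * (2 ^ m * Fintype.card ι)) ≤ 2 ^ c * 2 ^ L := Nat.mul_le_mul hc2 hL
      have h2 : 2 ^ m * ((A * m) ^ A * 2 ^ (m * k)) ≤ 2 ^ c * 2 ^ (A * m * A) := by
        calc _ = 2 ^ m * 2 ^ (m * k) * (A * m) ^ A := by ring
          _ ≤ _ := Nat.mul_le_mul hnP hqexp
      have h3 : c * (2 ^ m * ((A * m) ^ A * 2 ^ (m * k)) * L) ≤
          2 ^ c * (2 ^ c * 2 ^ (A * m * A) * 2 ^ L) := by gcongr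
      have e1 : 1 ≤ 2 ^ c := Nat.one_le_two_pow
      have e2 : 1 ≤ 2 ^ L := Nat.one_le_two_pow
      have e3 : 1 ≤ 2 ^ (A * m * A) := Nat.one_le_two_pow
      have hexpand : 2 ^ (3 * c + L + A * m * A + 2) =
          4 * (2 ^ c * (2 ^ c * (2 ^ c * 2 ^ (A * m * A) * 2 ^ L))) := by ring
      rw [hexpand]
      generalize 2 ^ c = X at *
      generalize 2 ^ L = Y at *
      generalize 2 ^ (A * m * A) = Z at *
      have h4 : X * Y ≤ X * (X * (X * Z * Y)) := by
        calc X * Y = X * (1 * (1 * 1 * Y)) := by ring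
          _ ≤ _ := by gcongr
      have h5 : X * 1 ≤ X * (X * (X * Z * Y)) := by
        calc X * 1 = X * (1 * (1 * 1 * 1)) := by ring
          _ ≤ _ := by gcongr
      have h6 := Nat.mul_le_mul_left X h3
      rw [mul_add]
      linarith
    · rw [show 2 ^ (m * (k + 1)) = 2 ^ m * 2 ^ (m * k) by ring]
      exact (hbound _ _ (Nat.one_le_two_pow) (Nat.one_le_two_pow)).1
    · have h := hbound (2 ^ m) (2 ^ (m * k)) Nat.one_le_two_pow Nat.one_le_two_pow
      rw [show 2 ^ (m * (k + 1 + 1)) = 2 ^ m * (2 ^ m * 2 ^ (m * k)) by ring,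
        show 2 ^ (m * (k + 1)) = 2 ^ m * 2 ^ (m * k) by ring]
      cases b with
      | false => simpa using h.2
      | true =>
        refine le_trans ?_ h.1
        simp only [if_true, add_zero]
        gcongr
        omega
    · exact (show 2 ^ (2 * m * (k + 1)) = 2 ^ m * (2 ^ m * 2 ^ (2 * m * k)) by ring) ▸ gf

/-- The unambiguous certificate complexity of the final function is `2 ^ (m * (k + 1))` up to the
polynomial factor, while its query complexity is `2 ^ (m * (2 * k + 1))`. -/
theorem exists_UC_le_and_le_Dquery (k : ℕ) : ∃ A : ℕ, ∀ m : ℕ, 1 ≤ m →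
    ∃ (n : ℕ) (f : (Fin n → Bool) → Bool), 2 ^ m ≤ UC f ∧
      UC f ≤ 2 * (A * m) ^ A * 2 ^ (m * (k + 1)) ∧ 2 ^ (m * (2 * k + 1)) ≤ Dquery f := by
  obtain ⟨A, hA⟩ := exists_hard_with_small_certificates k
  refine ⟨A, fun m hm => ?_⟩
  obtain ⟨ι, _, _, f, -, -, hW, hf⟩ := hA m hm
  obtain ⟨y, z, hy, hz⟩ : ∃ y z, f y = true ∧ f z = false := by
    have h1 : Hard f 1 Set.univ := hf.of_le Nat.one_le_two_pow
    obtain ⟨y, -, hy⟩ := h1.1 true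
    obtain ⟨z, -, hz⟩ := h1.1 false
    exact ⟨y, z, hy, hz⟩
  let e : Fin (2 ^ m) × ι ≃ Fin (Fintype.card (Fin (2 ^ m) × ι)) := Fintype.equivFin _
  let g : (Fin (Fintype.card (Fin (2 ^ m) × ι)) → Bool) → Bool :=
    fun x => nandComp (2 ^ m) f (x ∘ e)
  have hgW : UnambLE g fun _ => 2 * (A * m) ^ A * 2 ^ (m * (k + 1)) :=
    ((hW.nandComp (2 ^ m)).relabel e).mono fun b => by
      rw [show 2 ^ (m * (k + 1)) = 2 ^ m * 2 ^ (m * k) by ring]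
      cases b
      · simp only [if_true, Bool.false_eq_true, if_false]
        nlinarith [Nat.zero_le ((A * m) ^ A * (2 ^ m * 2 ^ (m * k)))]
      · simp only [if_true, Bool.false_eq_true, if_false]
        exact le_of_eq (by ring)
  refine ⟨_, g, ?_, max_le (hgW.UCb_le _) (hgW.UCb_le _), ?_⟩
  · let x : Fin (Fintype.card (Fin (2 ^ m) × ι)) → Bool := fun i => y (e.symm i).2
    have hx : g x = false := nandComp_eq_false.2 fun j => by simpa [x, Function.comp_def] using hy
    refine le_trans ?_ (le_max_left _ _)
    rw [← hx]
    refine hgW.le_UCb x fun s hs => ?_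
    rw [← Finset.card_map e.symm.toEmbedding]
    refine nandComp_card_cert (y := y) hz _ fun p hp => ?_
    have := hs (p ∘ e.symm) fun i hi => hp (e.symm i) (Finset.mem_map_of_mem _ hi)
    rw [hx] at this
    simpa [g, Function.comp_def] using this
  · refine Hard.le_Dquery ?_
    have := (hf.nandComp (by positivity) (2 ^ m)).relabel e
    rw [show 2 ^ (m * (2 * k + 1)) = 2 ^ m * 2 ^ (2 * m * k) by ring]
    exact this

theorem exists_le_and_mul_pow_le_two_pow (A M : ℕ) :
    ∃ m : ℕ, 1 ≤ m ∧ M ≤ m ∧ 2 * (A * m) ^ A ≤ 2 ^ m := by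
  have h := tendsto_pow_const_div_const_pow_of_one_lt A (one_lt_two : (1 : ℝ) < 2)
  have hpos : (0 : ℝ) < 1 / (2 * A ^ A + 1) := by positivity
  obtain ⟨m, hlt, hm⟩ := ((h.eventually (gt_mem_nhds hpos)).and
    (Filter.eventually_ge_atTop (M + 1))).exists
  refine ⟨m, by omega, by omega, ?_⟩
  rw [div_lt_div_iff₀ (by positivity) (by positivity)] at hlt
  have hm0 : (0 : ℝ) ≤ (m : ℝ) ^ A := by positivity
  have : (2 : ℝ) * (A * m) ^ A ≤ 2 ^ m := by
    rw [mul_pow]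
    linarith
  exact_mod_cast this

theorem stmt1 (ε : ℝ) (hε : 0 < ε) (M : ℕ) :
    ∃ (n : ℕ) (f : (Fin n → Bool) → Bool),
      M ≤ UC f ∧ (UC f : ℝ) ^ ((2 : ℝ) - ε) ≤ (Dquery f : ℝ) := by
  obtain ⟨k, hk⟩ := exists_nat_ge (4 / ε)
  obtain ⟨A, hA⟩ := exists_UC_le_and_le_Dquery k
  obtain ⟨m, hm, hMm, hAm⟩ := exists_le_and_mul_pow_le_two_pow A M
  obtain ⟨n, f, hlow, hup, hD⟩ := hA m hm
  refine ⟨n, f, (hMm.trans Nat.lt_two_pow_self.le).trans hlow, ?_⟩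
  have hD' : ((2 : ℝ) ^ (m * (2 * k + 1))) ≤ Dquery f := by exact_mod_cast hD
  refine le_trans ?_ hD'
  have hUC1 : (1 : ℝ) ≤ UC f := by exact_mod_cast Nat.one_le_two_pow.trans hlow
  rcases le_total (2 - ε) 0 with hneg | hpos
  · exact (Real.rpow_le_one_of_one_le_of_nonpos hUC1 hneg).trans (one_le_pow₀ one_le_two)
  · have hUC : (UC f : ℝ) ≤ 2 ^ (m * (k + 2)) := by
      have : UC f ≤ 2 ^ (m * (k + 2)) := by
        calc UC f ≤ 2 * (A * m) ^ A * 2 ^ (m * (k + 1)) := hup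
          _ ≤ 2 ^ m * 2 ^ (m * (k + 1)) := Nat.mul_le_mul_right _ hAm
          _ = 2 ^ (m * (k + 2)) := by ring
      exact_mod_cast this
    refine (Real.rpow_le_rpow (by positivity) hUC hpos).trans ?_
    rw [← Real.rpow_natCast, ← Real.rpow_natCast, ← Real.rpow_mul zero_le_two]
    refine Real.rpow_le_rpow_of_exponent_le one_le_two ?_
    rw [div_le_iff₀ hε] at hk
    have : ((k : ℝ) + 2) * (2 - ε) ≤ 2 * k + 1 := by nlinarith
    have hm0 : (0 : ℝ) ≤ m := Nat.cast_nonneg m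
    push_cast
    nlinarith [mul_le_mul_of_nonneg_left this hm0]
end
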